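/- arXiv:2311.00439 — 12 statements merged into one kernel-verified Lean document; each statement's English description precedes it below -/
import Mathlib

section
/- Validity part of Theorem 1 (bounds under stochastic monotonicity). Under the sample selection model with Assumptions 1 and 3, if Y₀* and Y₁* are integrable and the conditional distribution F₁ of Y given {D=1, S=1} is continuous and strictly increasing (atomless with everywhere positive density), and the positivity conditions hold, then ∇̲ ≤ τ ≤ ∇̄, where ∇̲ := E[Y | D=1, S=1, Y ≤ y¹_{ϑq₀}] − E[Y | D=0, S=1] and ∇̄ := E[Y | D=1, S=1, Y ≥ y¹_{1−ϑq₀}] − E[Y | D=0, S=1]. -/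
open MeasureTheory ProbabilityTheory Set

noncomputable section

variable {Ω : Type*} [MeasurableSpace Ω]

/-- Probability of an event as a real number. -/
def pr (μ : Measure Ω) (A : Set Ω) : ℝ := (μ A).toReal

/-- Conditional probability `P(B | A)`. -/
def cpr (μ : Measure Ω) (A B : Set Ω) : ℝ := pr μ (A ∩ B) / pr μ A

/-- Conditional expectation of `X` given the event `A`. -/
def cexp (μ : Measure Ω) (X : Ω → ℝ) (A : Set Ω) : ℝ := (∫ ω in A, X ω ∂μ) / pr μ A

lemma aux_indep_int {β : Type*} [MeasurableSpace β] (ν : Measure Ω) [IsFiniteMeasure ν]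
    (X : Ω → β) (D : Ω → ℝ) (hX : Measurable X) (hD : Measurable D) (h : IndepFun X D ν)
    (φ : β → ℝ) (hφ : Measurable φ) (U : Set β) (hU : MeasurableSet U)
    (V : Set ℝ) (hV : MeasurableSet V) :
    ∫ ω in X ⁻¹' U ∩ D ⁻¹' V, φ (X ω) ∂ν = (∫ ω in X ⁻¹' U, φ (X ω) ∂ν) * pr ν (D ⁻¹' V) := by
  have h1 := (h.comp (hφ.indicator hU)
    ((measurable_const (a := (1 : ℝ))).indicator hV)).integral_fun_mul_eq_mul_integral
    ((hφ.indicator hU).comp hX).aestronglyMeasurable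
    (((measurable_const (a := (1 : ℝ))).indicator hV).comp hD).aestronglyMeasurable
  have e1 : ∀ ω, (U.indicator φ ∘ X) ω * (V.indicator (fun _ => (1 : ℝ)) ∘ D) ω
      = (X ⁻¹' U ∩ D ⁻¹' V).indicator (fun ω => φ (X ω)) ω := by
    intro ω
    by_cases a : X ω ∈ U <;> by_cases b : D ω ∈ V <;> simp [Set.indicator, a, b]
  have e2 : (U.indicator φ ∘ X) = (X ⁻¹' U).indicator (fun ω => φ (X ω)) := by
    rfl
  have e3 : (V.indicator (fun _ => (1 : ℝ)) ∘ D) = (D ⁻¹' V).indicator (fun _ => (1 : ℝ)) := by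
    rfl
  simp_rw [e1] at h1
  rw [e2, e3, integral_indicator ((hX hU).inter (hD hV)), integral_indicator (hX hU),
    integral_indicator (hD hV)] at h1
  rw [h1]
  simp [pr, measureReal_def]

lemma aux_indep_cexp {β : Type*} [MeasurableSpace β] (ν : Measure Ω) [IsFiniteMeasure ν]
    (X : Ω → β) (D : Ω → ℝ) (hX : Measurable X) (hD : Measurable D) (h : IndepFun X D ν)
    (φ : β → ℝ) (hφ : Measurable φ) (U : Set β) (hU : MeasurableSet U)
    (V : Set ℝ) (hV : MeasurableSet V) (hp : 0 < pr ν (D ⁻¹' V)) :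
    cexp ν (fun ω => φ (X ω)) (X ⁻¹' U ∩ D ⁻¹' V) = cexp ν (fun ω => φ (X ω)) (X ⁻¹' U) := by
  unfold cexp
  rw [aux_indep_int ν X D hX hD h φ hφ U hU V hV]
  have : pr ν (X ⁻¹' U ∩ D ⁻¹' V) = pr ν (X ⁻¹' U) * pr ν (D ⁻¹' V) := by
    unfold pr
    rw [h.measure_inter_preimage_eq_mul _ _ hU hV, ENNReal.toReal_mul]
  rw [this, mul_div_mul_right _ _ hp.ne']

lemma aux_trim (ν : Measure Ω) [IsFiniteMeasure ν] (g : Ω → ℝ) (hg : Measurable g)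
    (hgi : Integrable g ν) (T A : Set Ω) (hT : MeasurableSet T) (hA : MeasurableSet A)
    (hAT : A ⊆ T) (c : ℝ) (hB : 0 < pr ν (T ∩ {ω | g ω ≤ c}))
    (hBA : pr ν (T ∩ {ω | g ω ≤ c}) ≤ pr ν A) :
    cexp ν g (T ∩ {ω | g ω ≤ c}) ≤ cexp ν g A := by
  set B := T ∩ {ω | g ω ≤ c} with hBdef
  have hBm : MeasurableSet B := hT.inter (measurableSet_le hg measurable_const)
  have hi : Integrable (fun ω => g ω - c) ν := hgi.sub (integrable_const c)
  have hsub : ∀ E : Set Ω, ∫ ω in E, (g ω - c) ∂ν = (∫ ω in E, g ω ∂ν) - c * pr ν E := by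
    intro E
    rw [integral_sub hgi.integrableOn (integrable_const c).integrableOn]
    simp [pr, measureReal_def, mul_comm]
  have hle : ∫ ω in B, (g ω - c) ∂ν ≤ ∫ ω in A, (g ω - c) ∂ν := by
    rw [← integral_indicator hBm, ← integral_indicator hA]
    refine integral_mono (hi.indicator hBm) (hi.indicator hA) ?_
    intro ω
    by_cases a : ω ∈ A
    · by_cases b : ω ∈ B
      · simp [Set.indicator, a, b]
      · have : c < g ω := by
          by_contra hc
          exact b ⟨hAT a, not_lt.mp hc⟩
        simp only [Set.indicator, a, b, if_true, if_false]; linarith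
    · by_cases b : ω ∈ B
      · have : g ω ≤ c := b.2
        simp only [Set.indicator, a, b, if_true, if_false]; linarith
      · simp [Set.indicator, a, b]
  have hneg : ∫ ω in B, (g ω - c) ∂ν ≤ 0 := by
    refine setIntegral_nonpos hBm ?_
    intro ω hω
    have : g ω ≤ c := hω.2
    linarith
  rw [hsub] at hle hneg
  rw [hsub] at hle
  unfold cexp
  have hApos : 0 < pr ν A := hB.trans_le hBA
  rw [div_le_div_iff₀ hB hApos]
  nlinarith [mul_nonneg (sub_nonneg.mpr hBA) (neg_nonneg.mpr hneg),
    mul_nonneg hB.le (sub_nonneg.mpr hle)]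

lemma aux_trim' (ν : Measure Ω) [IsFiniteMeasure ν] (g : Ω → ℝ) (hg : Measurable g)
    (hgi : Integrable g ν) (T A : Set Ω) (hT : MeasurableSet T) (hA : MeasurableSet A)
    (hAT : A ⊆ T) (c : ℝ) (hB : 0 < pr ν (T ∩ {ω | c ≤ g ω}))
    (hBA : pr ν (T ∩ {ω | c ≤ g ω}) ≤ pr ν A) :
    cexp ν g A ≤ cexp ν g (T ∩ {ω | c ≤ g ω}) := by
  have e : {ω | (-g) ω ≤ -c} = {ω | c ≤ g ω} := by ext; simp
  have h := aux_trim ν (-g) hg.neg hgi.neg T A hT hA hAT (-c) (by rwa [e]) (by rwa [e])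
  rw [e] at h
  unfold cexp at h ⊢
  simp only [Pi.neg_apply, integral_neg, neg_div] at h
  linarith

lemma aux_pr_mono (ν : Measure Ω) [IsFiniteMeasure ν] {A B : Set Ω} (h : A ⊆ B) :
    pr ν A ≤ pr ν B :=
  ENNReal.toReal_mono (measure_ne_top _ _) (measure_mono h)

lemma aux_cdf (ν : Measure Ω) [IsFiniteMeasure ν] (g : Ω → ℝ) (hg : Measurable g)
    (T : Set Ω) (hT : MeasurableSet T) (hp : 0 < pr ν T) :
    Filter.Tendsto (fun t => pr ν (T ∩ {ω | g ω ≤ t}) / pr ν T) Filter.atBot (nhds 0) ∧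
    Filter.Tendsto (fun t => pr ν (T ∩ {ω | g ω ≤ t}) / pr ν T) Filter.atTop (nhds 1) := by
  have hne : ν T ≠ 0 := by
    intro h; simp [pr, h] at hp
  have := cond_isProbabilityMeasure hne
  have : IsProbabilityMeasure ((ν[|T]).map g) :=
    Measure.isProbabilityMeasure_map hg.aemeasurable
  have e : (fun t => pr ν (T ∩ {ω | g ω ≤ t}) / pr ν T) = cdf ((ν[|T]).map g) := by
    ext t
    rw [cdf_eq_real, measureReal_def, Measure.map_apply hg measurableSet_Iic, cond_apply hT,
      ENNReal.toReal_mul, ENNReal.toReal_inv, div_eq_inv_mul]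
    rfl
  rw [e]
  exact ⟨tendsto_cdf_atBot _, tendsto_cdf_atTop _⟩

lemma aux_q_lower (F : ℝ → ℝ) (hc : Continuous F)
    (h0 : Filter.Tendsto F Filter.atBot (nhds 0)) (hm : StrictMono F) (r : ℝ) (hr : 0 < r) :
    F (sInf {t | r ≤ F t}) ≤ r := by
  have hb : BddBelow {t | r ≤ F t} := by
    obtain ⟨a, ha⟩ := (h0.eventually (gt_mem_nhds hr)).exists
    exact ⟨a, fun t ht => (hm.lt_iff_lt.mp (lt_of_lt_of_le ha ht)).le⟩
  refine le_of_tendsto (hc.tendsto _ |>.mono_left (nhdsWithin_le_nhds (s := Iio (sInf {t | r ≤ F t})))) ?_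
  filter_upwards [self_mem_nhdsWithin] with t ht
  by_contra h
  exact absurd (csInf_le hb (le_of_not_ge h)) (not_le.mpr ht)

lemma aux_q_upper (F : ℝ → ℝ) (hc : Continuous F)
    (h0 : Filter.Tendsto F Filter.atBot (nhds 0))
    (h1 : Filter.Tendsto F Filter.atTop (nhds 1)) (hm : StrictMono F) (r : ℝ)
    (hr : 0 < r) (hr1 : r < 1) :
    r ≤ F (sInf {t | r ≤ F t}) := by
  have hb : BddBelow {t | r ≤ F t} := by
    obtain ⟨a, ha⟩ := (h0.eventually (gt_mem_nhds hr)).exists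
    exact ⟨a, fun t ht => (hm.lt_iff_lt.mp (lt_of_lt_of_le ha ht)).le⟩
  have hn : {t | r ≤ F t}.Nonempty := by
    obtain ⟨a, ha⟩ := (h1.eventually (lt_mem_nhds hr1)).exists
    exact ⟨a, ha.le⟩
  exact (isClosed_le continuous_const hc).csInf_mem hn hb

/-- **Theorem 1 (validity part).** Under the sample selection model with independent
assignment (Assumption 1) and stochastic monotonicity (Assumption 3), the treatment
effect for always-takers `τ` lies between the trimmed-mean bounds `∇̲` and `∇̄`. -/
theorem lee_bounds_stochastic_monotonicity_validity
    (μ : Measure Ω) [IsProbabilityMeasure μ]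
    (Y1 Y0 S1 S0 D S Y : Ω → ℝ)
    (hY1m : Measurable Y1) (hY0m : Measurable Y0)
    (hS1m : Measurable S1) (hS0m : Measurable S0) (hDm : Measurable D)
    (hS1v : ∀ ω, S1 ω = 0 ∨ S1 ω = 1) (hS0v : ∀ ω, S0 ω = 0 ∨ S0 ω = 1)
    (hDv : ∀ ω, D ω = 0 ∨ D ω = 1)
    (hS : ∀ ω, S ω = S1 ω * D ω + S0 ω * (1 - D ω))
    (hY : ∀ ω, Y ω = S ω * (Y1 ω * D ω + Y0 ω * (1 - D ω)))
    (hY1i : Integrable Y1 μ) (hY0i : Integrable Y0 μ)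
    -- Assumption 1 (independent assignment)
    (hIndep : IndepFun (fun ω => (Y1 ω, Y0 ω, S1 ω, S0 ω)) D μ)
    -- Assumption 3 (stochastic monotonicity)
    (ϑL : ℝ) (hϑL : ϑL ∈ Set.Ioc (0 : ℝ) 1)
    (hSM1 : ϑL ≤ cpr μ {ω | S0 ω = 1} {ω | S1 ω = 1})
    (hSM2 : IndepFun (fun ω => (Y1 ω, Y0 ω)) S1 (μ[|{ω | S0 ω = 1}]))
    -- identified quantities
    (α0 q0 ϑF ϑ τ : ℝ) (F1 : ℝ → ℝ) (yq : ℝ → ℝ)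
    (hα0 : α0 = cpr μ {ω | D ω = 0} {ω | S ω = 1})
    (hq0 : q0 = cpr μ {ω | D ω = 0} {ω | S ω = 1} / cpr μ {ω | D ω = 1} {ω | S ω = 1})
    (hϑF : ϑF = 1 + 1 / q0 - 1 / α0)
    (hϑ : ϑ = max ϑL ϑF)
    (hF1 : ∀ t, F1 t = cpr μ {ω | D ω = 1 ∧ S ω = 1} {ω | Y ω ≤ t})
    (hyq : ∀ r, yq r = sInf {t : ℝ | r ≤ F1 t})
    (hF1cont : Continuous F1) (hF1mono : StrictMono F1)
    (hτ : τ = cexp μ (fun ω => Y1 ω - Y0 ω) {ω | S0 ω = 1 ∧ S1 ω = 1})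
    -- positivity conditions
    (hD1 : 0 < pr μ {ω | D ω = 1}) (hD1' : pr μ {ω | D ω = 1} < 1)
    (hSD0 : 0 < pr μ {ω | S ω = 1 ∧ D ω = 0})
    (hSD1 : 0 < pr μ {ω | S ω = 1 ∧ D ω = 1})
    (hAT : 0 < pr μ {ω | S0 ω = 1 ∧ S1 ω = 1}) :
    cexp μ Y {ω | D ω = 1 ∧ S ω = 1 ∧ Y ω ≤ yq (ϑ * q0)}
        - cexp μ Y {ω | D ω = 0 ∧ S ω = 1} ≤ τ ∧
      τ ≤ cexp μ Y {ω | D ω = 1 ∧ S ω = 1 ∧ yq (1 - ϑ * q0) ≤ Y ω}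
        - cexp μ Y {ω | D ω = 0 ∧ S ω = 1} := by
  set X : Ω → ℝ × ℝ × ℝ × ℝ := fun ω => (Y1 ω, Y0 ω, S1 ω, S0 ω) with hXdef
  have hXm : Measurable X := by fun_prop
  set T : Set Ω := {ω | S1 ω = 1} with hTdef
  set Z : Set Ω := {ω | S0 ω = 1} with hZdef
  have hTm : MeasurableSet T := hS1m (measurableSet_singleton 1)
  have hZm : MeasurableSet Z := hS0m (measurableSet_singleton 1)
  have hAeq : {ω | S0 ω = 1 ∧ S1 ω = 1} = Z ∩ T := rfl
  rw [hAeq] at hAT hτ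
  have hD1p : 0 < pr μ (D ⁻¹' {1}) := hD1
  have hD0p : 0 < pr μ (D ⁻¹' {0}) :=
    hSD0.trans_le (aux_pr_mono μ (fun ω h => h.2))
  -- sets
  have hU1 : MeasurableSet {x : ℝ × ℝ × ℝ × ℝ | x.2.2.1 = 1} :=
    measurableSet_eq_fun (by fun_prop) measurable_const
  have hU0 : MeasurableSet {x : ℝ × ℝ × ℝ × ℝ | x.2.2.2 = 1} :=
    measurableSet_eq_fun (by fun_prop) measurable_const
  have hprmul : ∀ (U : Set (ℝ × ℝ × ℝ × ℝ)) (d : ℝ), MeasurableSet U →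
      pr μ (X ⁻¹' U ∩ D ⁻¹' {d}) = pr μ (X ⁻¹' U) * pr μ (D ⁻¹' {d}) := by
    intro U d hU
    unfold pr
    rw [hIndep.measure_inter_preimage_eq_mul _ _ hU (measurableSet_singleton d),
      ENNReal.toReal_mul]
  have hS_1 : ∀ ω, D ω = 1 → S ω = S1 ω := by intro ω h; rw [hS, h]; ring
  have hS_0 : ∀ ω, D ω = 0 → S ω = S0 ω := by intro ω h; rw [hS, h]; ring
  have hY_1 : ∀ ω, D ω = 1 → S1 ω = 1 → Y ω = Y1 ω := by
    intro ω h h'; rw [hY, hS_1 ω h, h, h']; ring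
  have hY_0 : ∀ ω, D ω = 0 → S0 ω = 1 → Y ω = Y0 ω := by
    intro ω h h'; rw [hY, hS_0 ω h, h, h']; ring
  -- events under treatment
  have ev1 : ∀ p : ℝ → Prop, {ω | D ω = 1 ∧ S ω = 1 ∧ p (Y ω)}
      = X ⁻¹' ({x | x.2.2.1 = 1} ∩ {x | p x.1}) ∩ D ⁻¹' {1} := by
    intro p; ext ω
    constructor
    · rintro ⟨a, b, c⟩
      have b' : S1 ω = 1 := by rw [← hS_1 ω a]; exact b
      rw [hY_1 ω a b'] at c
      exact ⟨⟨b', c⟩, a⟩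
    · rintro ⟨⟨b, c⟩, a⟩
      have a' : D ω = 1 := a
      have b' : S1 ω = 1 := b
      refine ⟨a', by rw [hS_1 ω a']; exact b', ?_⟩
      rw [hY_1 ω a' b']; exact c
  have evD1 : {ω | D ω = 1 ∧ S ω = 1} = X ⁻¹' {x | x.2.2.1 = 1} ∩ D ⁻¹' {1} := by
    have := ev1 (fun _ => True)
    simpa using this
  have evD0 : {ω | D ω = 0 ∧ S ω = 1} = X ⁻¹' {x | x.2.2.2 = 1} ∩ D ⁻¹' {0} := by
    ext ω
    constructor
    · rintro ⟨a, b⟩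
      exact ⟨by rw [hS_0 ω a] at b; exact b, a⟩
    · rintro ⟨b, a⟩
      have a' : D ω = 0 := a
      exact ⟨a', by rw [hS_0 ω a']; exact b⟩
  have hTp : 0 < pr μ T := hAT.trans_le (aux_pr_mono μ inter_subset_right)
  have hZp : 0 < pr μ Z := hAT.trans_le (aux_pr_mono μ inter_subset_left)
  have hc1 : cpr μ {ω | D ω = 1} {ω | S ω = 1} = pr μ T := by
    unfold cpr
    have : {ω | D ω = 1} ∩ {ω | S ω = 1} = X ⁻¹' {x | x.2.2.1 = 1} ∩ D ⁻¹' {1} := evD1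
    rw [this, hprmul _ _ hU1]
    exact mul_div_cancel_right₀ _ hD1p.ne'
  have hc0 : cpr μ {ω | D ω = 0} {ω | S ω = 1} = pr μ Z := by
    unfold cpr
    have : {ω | D ω = 0} ∩ {ω | S ω = 1} = X ⁻¹' {x | x.2.2.2 = 1} ∩ D ⁻¹' {0} := evD0
    rw [this, hprmul _ _ hU0]
    exact mul_div_cancel_right₀ _ hD0p.ne'
  rw [hc0] at hα0
  rw [hc0, hc1] at hq0
  -- F1
  have hF : F1 = fun t => pr μ (T ∩ {ω | Y1 ω ≤ t}) / pr μ T := by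
    ext t
    rw [hF1]
    unfold cpr
    have e : {ω | D ω = 1 ∧ S ω = 1} ∩ {ω | Y ω ≤ t}
        = X ⁻¹' ({x | x.2.2.1 = 1} ∩ {x | x.1 ≤ t}) ∩ D ⁻¹' {1} := by
      rw [← ev1 (fun y => y ≤ t)]
      ext ω; simp [and_assoc]
    rw [e, evD1, hprmul _ _ hU1,
      hprmul _ _ (hU1.inter (measurableSet_le (by fun_prop) measurable_const)),
      mul_div_mul_right _ _ hD1p.ne']
    rfl
  obtain ⟨hF0lim, hF1lim⟩ := aux_cdf μ Y1 hY1m T hTm hTp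
  rw [← hF] at hF0lim hF1lim
  have hFT : ∀ t, pr μ (T ∩ {ω | Y1 ω ≤ t}) = F1 t * pr μ T := by
    intro t; rw [hF]; field_simp
  have hFpos : ∀ t, 0 < F1 t := by
    intro t
    have : 0 ≤ F1 (t - 1) := by
      rw [hF]; exact div_nonneg ENNReal.toReal_nonneg ENNReal.toReal_nonneg
    exact this.trans_lt (hF1mono (by linarith))
  have hFlt : ∀ t, F1 t < 1 := by
    intro t
    have : F1 (t + 1) ≤ 1 := by
      rw [hF]; exact (div_le_one hTp).mpr (aux_pr_mono μ inter_subset_left)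
    exact (hF1mono (by linarith)).trans_le this
  -- r
  have hunion : pr μ (Z ∪ T) + pr μ (Z ∩ T) = pr μ Z + pr μ T := by
    have := measureReal_union_add_inter (μ := μ) (s := Z) hTm
    simpa [pr, measureReal_def] using this
  have hle1 : pr μ (Z ∪ T) ≤ 1 := by
    have := aux_pr_mono μ (subset_univ (Z ∪ T))
    simpa [pr] using this
  have hϑle : ϑ ≤ pr μ (Z ∩ T) / pr μ Z := by
    rw [hϑ]
    refine max_le hSM1 ?_
    rw [hϑF, hq0, hα0, le_div_iff₀ hZp]
    have : (1 + 1 / (pr μ Z / pr μ T) - 1 / pr μ Z) * pr μ Z = pr μ Z + pr μ T - 1 := by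
      field_simp
    rw [this]; linarith
  have hϑpos : 0 < ϑ := by rw [hϑ]; exact lt_of_lt_of_le hϑL.1 (le_max_left _ _)
  have hq0p : 0 < q0 := by rw [hq0]; positivity
  have hr : 0 < ϑ * q0 := mul_pos hϑpos hq0p
  have hrA : ϑ * q0 * pr μ T ≤ pr μ (Z ∩ T) := by
    have e : ϑ * q0 * pr μ T = ϑ * pr μ Z := by rw [hq0]; field_simp
    rw [e]; exact (le_div_iff₀ hZp).mp hϑle
  have hr1 : ϑ * q0 ≤ 1 := by
    have := aux_pr_mono μ (inter_subset_right : Z ∩ T ⊆ T)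
    by_contra h
    nlinarith [not_le.mp h]
  have hYc1 : ∀ p : ℝ → Prop, MeasurableSet {y | p y} →
      cexp μ Y {ω | D ω = 1 ∧ S ω = 1 ∧ p (Y ω)} = cexp μ Y1 (T ∩ {ω | p (Y1 ω)}) := by
    intro p hp
    have hU : MeasurableSet ({x : ℝ × ℝ × ℝ × ℝ | x.2.2.1 = 1} ∩ {x | p x.1}) :=
      hU1.inter (measurable_fst hp)
    have h2 := aux_indep_cexp μ X D hXm hDm hIndep (fun x => x.1) measurable_fst _ hU
      {1} (measurableSet_singleton 1) hD1p
    rw [ev1 p]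
    refine Eq.trans ?_ h2
    unfold cexp
    congr 1
    refine setIntegral_congr_fun ((hXm hU).inter (hDm (measurableSet_singleton 1))) ?_
    rintro ω ⟨⟨b, _⟩, a⟩
    exact hY_1 ω a b
  have hYc0 : cexp μ Y {ω | D ω = 0 ∧ S ω = 1} = cexp μ Y0 Z := by
    have h2 := aux_indep_cexp μ X D hXm hDm hIndep (fun x => x.2.1) (by fun_prop) _ hU0
      {0} (measurableSet_singleton 0) hD0p
    rw [evD0]
    refine Eq.trans ?_ h2
    unfold cexp
    congr 1
    refine setIntegral_congr_fun ((hXm hU0).inter (hDm (measurableSet_singleton 0))) ?_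
    rintro ω ⟨b, a⟩
    exact hY_0 ω a b
  -- always-takers
  have hZne : μ Z ≠ 0 := by
    intro h; simp [pr, h] at hZp
  have hY0Z : cexp μ Y0 (Z ∩ T) = cexp μ Y0 Z := by
    have := cond_isProbabilityMeasure hZne
    have h3 := aux_indep_int (μ[|Z]) (fun ω => (Y1 ω, Y0 ω)) S1 (by fun_prop) hS1m hSM2
      (fun x => x.2) measurable_snd univ MeasurableSet.univ {1} (measurableSet_singleton 1)
    have hTT : S1 ⁻¹' {1} = T := rfl
    rw [preimage_univ, univ_inter, hTT, Measure.restrict_univ] at h3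
    simp only [ProbabilityTheory.cond, Measure.restrict_smul, integral_smul_measure,
      Measure.restrict_restrict hTm, pr, Measure.smul_apply, smul_eq_mul,
      Measure.restrict_apply hTm, ENNReal.toReal_mul, ENNReal.toReal_inv] at h3
    rw [inter_comm T Z] at h3
    change (pr μ Z)⁻¹ * _ = (pr μ Z)⁻¹ * _ * ((pr μ Z)⁻¹ * pr μ (Z ∩ T)) at h3
    unfold cexp
    rw [div_eq_div_iff hAT.ne' hZp.ne']
    field_simp at h3
    linarith
  have hτ' : τ = cexp μ Y1 (Z ∩ T) - cexp μ Y0 Z := by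
    rw [hτ, ← hY0Z]
    unfold cexp
    rw [integral_sub hY1i.integrableOn hY0i.integrableOn, sub_div]
  rw [hYc0, hτ', hYc1 (fun y => y ≤ yq (ϑ * q0)) measurableSet_Iic,
    hYc1 (fun y => yq (1 - ϑ * q0) ≤ y) measurableSet_Ici]
  constructor
  · refine sub_le_sub_right ?_ _
    refine aux_trim μ Y1 hY1m hY1i T (Z ∩ T) hTm (hZm.inter hTm) inter_subset_right _ ?_ ?_
    · rw [hFT]; exact mul_pos (hFpos _) hTp
    · rw [hFT]
      refine le_trans (mul_le_mul_of_nonneg_right ?_ hTp.le) hrA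
      rw [hyq]
      exact aux_q_lower F1 hF1cont hF0lim hF1mono _ hr
  · refine sub_le_sub_right ?_ _
    set c := yq (1 - ϑ * q0) with hcdef
    have hsplit : pr μ (T ∩ {ω | Y1 ω < c}) + pr μ (T ∩ {ω | c ≤ Y1 ω}) = pr μ T := by
      have := measureReal_inter_add_sdiff (μ := μ) (s := T) (measurableSet_lt hY1m measurable_const
        : MeasurableSet {ω | Y1 ω < c})
      have e : T \ {ω | Y1 ω < c} = T ∩ {ω | c ≤ Y1 ω} := by
        ext ω; simp
      rw [e] at this
      exact this
    refine aux_trim' μ Y1 hY1m hY1i T (Z ∩ T) hTm (hZm.inter hTm) inter_subset_right _ ?_ ?_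
    · have h1 : pr μ (T ∩ {ω | Y1 ω < c}) ≤ pr μ (T ∩ {ω | Y1 ω ≤ c}) :=
        aux_pr_mono μ (inter_subset_inter_right _ (fun ω (h : Y1 ω < c) => (show Y1 ω ≤ c from h.le)))
      rw [hFT] at h1
      nlinarith [mul_pos (sub_pos.mpr (hFlt c)) hTp]
    · have h1 : F1 c * pr μ T ≤ pr μ (T ∩ {ω | Y1 ω < c}) := by
        refine le_of_tendsto (((hF1cont.tendsto c).mul_const _).mono_left
          (nhdsWithin_le_nhds (s := Iio c))) ?_
        filter_upwards [self_mem_nhdsWithin] with t ht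
        rw [← hFT]
        exact aux_pr_mono μ (inter_subset_inter_right _ (fun ω (h : Y1 ω ≤ t) =>
          (show Y1 ω < c from lt_of_le_of_lt h ht)))
      refine le_trans ?_ hrA
      have h2 : 1 - ϑ * q0 ≤ F1 c := by
        rcases hr1.lt_or_eq with h | h
        · rw [hcdef, hyq]
          exact aux_q_upper F1 hF1cont hF0lim hF1lim hF1mono _ (by linarith) (by linarith)
        · rw [h]; linarith [hFpos c]
      nlinarith [mul_le_mul_of_nonneg_right h2 hTp.le]

end
end

section
/- Mixture trimming bounds for functionals respecting stochastic dominance (Horowitz–Manski Proposition 4, validity part). Let Q, P₀, P₁ be Borel probability measures on ℝ with Q = p·P₀ + (1−p)·P₁, where p ∈ [0, λ] and λ ∈ (0,1), and suppose the CDF of Q is continuous and strictly increasing, with r-quantile y_r := inf{t : Q((−∞,t]) ≥ r}. Define the truncated distributions L_λ(t) := Q((−∞,t])/(1−λ) for t < y_{1−λ} and L_λ(t) := 1 for t ≥ y_{1−λ}, and U_λ(t) := max{(Q((−∞,t]) − λ)/(1−λ), 0}. If ρ is a real-valued functional on Borel probability measures on ℝ that respects first-order stochastic dominance (whenever the CDF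 of μ is pointwise ≤ the CDF of ν, then ρ(μ) ≥ ρ(ν)), then ρ(L_λ) ≤ ρ(P₁) ≤ ρ(U_λ). -/
open MeasureTheory ProbabilityTheory Set

noncomputable section

variable {Ω : Type*} [MeasurableSpace Ω]

/-- **Horowitz–Manski Proposition 4 (validity part).** If `Q = p·P₀ + (1−p)·P₁` with
`p ≤ λ < 1`, and `ρ` respects first-order stochastic dominance, then
`ρ(L_λ) ≤ ρ(P₁) ≤ ρ(U_λ)`, where `L_λ` and `U_λ` keep the lowest and highest `1−λ`
fraction of the mass of `Q`, respectively. -/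
theorem horowitz_manski_prop4
    (Q P0 P1 : Measure ℝ)
    [IsProbabilityMeasure Q] [IsProbabilityMeasure P0] [IsProbabilityMeasure P1]
    (p lam : ℝ) (hp : p ∈ Set.Icc 0 lam) (hlam : lam ∈ Set.Ioo (0 : ℝ) 1)
    (hmix : Q = ENNReal.ofReal p • P0 + ENNReal.ofReal (1 - p) • P1)
    (cdfQ : ℝ → ℝ) (hcdfQ : ∀ t, cdfQ t = (Q (Set.Iic t)).toReal)
    (hQcont : Continuous cdfQ) (hQmono : StrictMono cdfQ)
    (yq : ℝ → ℝ) (hyq : ∀ r, yq r = sInf {t : ℝ | r ≤ cdfQ t})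
    -- ρ respects first-order stochastic dominance
    (ρ : Measure ℝ → ℝ)
    (hρ : ∀ ν ν' : Measure ℝ, IsProbabilityMeasure ν → IsProbabilityMeasure ν' →
      (∀ t, (ν (Set.Iic t)).toReal ≤ (ν' (Set.Iic t)).toReal) → ρ ν' ≤ ρ ν)
    -- the lower- and upper-truncated distributions
    (L U : Measure ℝ) [IsProbabilityMeasure L] [IsProbabilityMeasure U]
    (hL : ∀ t, (L (Set.Iic t)).toReal =
      if t < yq (1 - lam) then cdfQ t / (1 - lam) else 1)
    (hU : ∀ t, (U (Set.Iic t)).toReal = max ((cdfQ t - lam) / (1 - lam)) 0) :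
    ρ L ≤ ρ P1 ∧ ρ P1 ≤ ρ U := by
  obtain ⟨hp0, hpl⟩ := hp
  obtain ⟨hl0, hl1⟩ := hlam
  have hd : 0 < 1 - lam := by linarith
  have key : ∀ t, cdfQ t = p * (P0 (Set.Iic t)).toReal + (1 - p) * (P1 (Set.Iic t)).toReal := by
    intro t
    rw [hcdfQ, hmix]
    simp only [Measure.add_apply, Measure.smul_apply, smul_eq_mul]
    rw [ENNReal.toReal_add (ENNReal.mul_ne_top ENNReal.ofReal_ne_top (measure_ne_top _ _))
      (ENNReal.mul_ne_top ENNReal.ofReal_ne_top (measure_ne_top _ _)),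
      ENNReal.toReal_mul, ENNReal.toReal_mul, ENNReal.toReal_ofReal hp0,
      ENNReal.toReal_ofReal (by linarith)]
  have le1 : ∀ (μ : Measure ℝ) [IsProbabilityMeasure μ] (t : ℝ), (μ (Set.Iic t)).toReal ≤ 1 := by
    intro μ _ t
    exact measureReal_le_one
  have nn : ∀ (μ : Measure ℝ) (t : ℝ), 0 ≤ (μ (Set.Iic t)).toReal :=
    fun μ t => ENNReal.toReal_nonneg
  constructor
  · refine hρ P1 L inferInstance inferInstance fun t => ?_
    rw [hL]
    split_ifs
    · rw [le_div_iff₀ hd, key]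
      nlinarith [mul_nonneg hp0 (nn P0 t), mul_nonneg (sub_nonneg.2 hpl) (nn P1 t)]
    · exact le1 P1 t
  · refine hρ U P1 inferInstance inferInstance fun t => ?_
    rw [hU]
    refine max_le ?_ (nn P1 t)
    rw [div_le_iff₀ hd, key]
    nlinarith [mul_nonneg hp0 (sub_nonneg.2 (le1 P0 t)),
      mul_nonneg (sub_nonneg.2 hpl) (sub_nonneg.2 (le1 P1 t))]

end
end

section
/- Identification of the cross-stratum selection probability. In the sample selection model with Assumption 1, if 0 < P(D=1) < 1, P(S₀=1) > 0, P(S₀=0) > 0 and P(S=1|D=0) < 1, then P(S₁=1 | S₀=0) = [P(S=1 | D=1) − P(S₁=1 | S₀=1)·P(S=1 | D=0)] / (1 − P(S=1 | D=0)). -/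
open MeasureTheory ProbabilityTheory Set

noncomputable section

variable {Ω : Type*} [MeasurableSpace Ω]

/-- **Identification of the cross-stratum selection probability.** Under Assumption 1,
`P(S₁=1 | S₀=0) = (P(S=1|D=1) − P(S₁=1|S₀=1)·P(S=1|D=0)) / (1 − P(S=1|D=0))`. -/
theorem cross_stratum_identification
    (μ : Measure Ω) [IsProbabilityMeasure μ]
    (Y1 Y0 S1 S0 D S Y : Ω → ℝ)
    (hY1m : Measurable Y1) (hY0m : Measurable Y0)
    (hS1m : Measurable S1) (hS0m : Measurable S0) (hDm : Measurable D)
    (hS1v : ∀ ω, S1 ω = 0 ∨ S1 ω = 1) (hS0v : ∀ ω, S0 ω = 0 ∨ S0 ω = 1)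
    (hDv : ∀ ω, D ω = 0 ∨ D ω = 1)
    (hS : ∀ ω, S ω = S1 ω * D ω + S0 ω * (1 - D ω))
    (hY : ∀ ω, Y ω = S ω * (Y1 ω * D ω + Y0 ω * (1 - D ω)))
    -- Assumption 1 (independent assignment)
    (hIndep : IndepFun (fun ω => (Y1 ω, Y0 ω, S1 ω, S0 ω)) D μ)
    -- positivity conditions
    (hD1 : 0 < pr μ {ω | D ω = 1}) (hD1' : pr μ {ω | D ω = 1} < 1)
    (hS0pos : 0 < pr μ {ω | S0 ω = 1}) (hS0neg : 0 < pr μ {ω | S0 ω = 0})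
    (hlt : cpr μ {ω | D ω = 0} {ω | S ω = 1} < 1) :
    cpr μ {ω | S0 ω = 0} {ω | S1 ω = 1}
      = (cpr μ {ω | D ω = 1} {ω | S ω = 1}
          - cpr μ {ω | S0 ω = 1} {ω | S1 ω = 1} * cpr μ {ω | D ω = 0} {ω | S ω = 1})
        / (1 - cpr μ {ω | D ω = 0} {ω | S ω = 1}) := by
  have mS1 : MeasurableSet {ω | S1 ω = 1} := hS1m (measurableSet_singleton 1)
  have mS0 : MeasurableSet {ω | S0 ω = 1} := hS0m (measurableSet_singleton 1)
  have mD : MeasurableSet {ω | D ω = 1} := hDm (measurableSet_singleton 1)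
  have cD : {ω | D ω = 0} = {ω | D ω = 1}ᶜ := by
    ext ω; rcases hDv ω with h | h <;> simp [h]
  have cS0 : {ω | S0 ω = 0} = {ω | S0 ω = 1}ᶜ := by
    ext ω; rcases hS0v ω with h | h <;> simp [h]
  have pD : pr μ {ω | D ω = 0} = 1 - pr μ {ω | D ω = 1} := by
    rw [cD]; exact probReal_compl_eq_one_sub mD
  have pS0 : pr μ {ω | S0 ω = 0} = 1 - pr μ {ω | S0 ω = 1} := by
    rw [cS0]; exact probReal_compl_eq_one_sub mS0
  have hI1 : IndepFun S1 D μ :=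
    hIndep.comp (φ := fun p : ℝ × ℝ × ℝ × ℝ => p.2.2.1) (ψ := id) (by fun_prop) measurable_id
  have hI0 : IndepFun S0 D μ :=
    hIndep.comp (φ := fun p : ℝ × ℝ × ℝ × ℝ => p.2.2.2) (ψ := id) (by fun_prop) measurable_id
  have e1 : pr μ ({ω | D ω = 1} ∩ {ω | S ω = 1})
      = pr μ {ω | S1 ω = 1} * pr μ {ω | D ω = 1} := by
    have h : {ω | D ω = 1} ∩ {ω | S ω = 1} = S1 ⁻¹' {1} ∩ D ⁻¹' {1} := by
      ext ω; rcases hDv ω with h | h <;> simp [h, hS]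
    rw [h, pr, hI1.measure_inter_preimage_eq_mul _ _ (measurableSet_singleton 1)
      (measurableSet_singleton 1), ENNReal.toReal_mul]
    rfl
  have e0 : pr μ ({ω | D ω = 0} ∩ {ω | S ω = 1})
      = pr μ {ω | S0 ω = 1} * pr μ {ω | D ω = 0} := by
    have h : {ω | D ω = 0} ∩ {ω | S ω = 1} = S0 ⁻¹' {1} ∩ D ⁻¹' {0} := by
      ext ω; rcases hDv ω with h | h <;> simp [h, hS]
    rw [h, pr, hI0.measure_inter_preimage_eq_mul _ _ (measurableSet_singleton 1)
      (measurableSet_singleton 0), ENNReal.toReal_mul]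
    rfl
  have tot : pr μ ({ω | S0 ω = 1} ∩ {ω | S1 ω = 1}) + pr μ ({ω | S0 ω = 0} ∩ {ω | S1 ω = 1})
      = pr μ {ω | S1 ω = 1} := by
    rw [cS0, inter_comm, inter_comm _ {ω | S1 ω = 1}, ← diff_eq]
    exact measureReal_inter_add_diff mS0
  have hD0 : pr μ {ω | D ω = 0} ≠ 0 := by rw [pD]; linarith
  have c1 : cpr μ {ω | D ω = 1} {ω | S ω = 1} = pr μ {ω | S1 ω = 1} := by
    rw [cpr, e1, mul_div_assoc, div_self hD1.ne', mul_one]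
  have c0 : cpr μ {ω | D ω = 0} {ω | S ω = 1} = pr μ {ω | S0 ω = 1} := by
    rw [cpr, e0, mul_div_assoc, div_self hD0, mul_one]
  rw [c1, c0, ← pS0, cpr, cpr, div_mul_cancel₀ _ hS0pos.ne', ← tot, add_sub_cancel_left]

end
end

section
/- Upper bound on the cross-stratum selection probability under stochastic monotonicity. In the sample selection model with Assumption 1 and Assumption 3(i) (P(S₁=1|S₀=1) ≥ ϑ_L for a constant ϑ_L ∈ (0,1]), if 0 < P(D=1) < 1, P(S₀=1) > 0, P(S₀=0) > 0 and P(S=1|D=0) < 1, then P(S₁=1 | S₀=0) ≤ [P(S=1 | D=1) − ϑ_L·P(S=1 | D=0)] / (1 − P(S=1 | D=0)). -/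
open MeasureTheory ProbabilityTheory Set

noncomputable section

variable {Ω : Type*} [MeasurableSpace Ω]

/-- **Upper bound on the cross-stratum selection probability.** Under Assumptions 1 and
3(i), `P(S₁=1 | S₀=0) ≤ (P(S=1|D=1) − ϑ_L·P(S=1|D=0)) / (1 − P(S=1|D=0))`. -/
theorem cross_stratum_upper_bound
    (μ : Measure Ω) [IsProbabilityMeasure μ]
    (Y1 Y0 S1 S0 D S Y : Ω → ℝ)
    (hY1m : Measurable Y1) (hY0m : Measurable Y0)
    (hS1m : Measurable S1) (hS0m : Measurable S0) (hDm : Measurable D)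
    (hS1v : ∀ ω, S1 ω = 0 ∨ S1 ω = 1) (hS0v : ∀ ω, S0 ω = 0 ∨ S0 ω = 1)
    (hDv : ∀ ω, D ω = 0 ∨ D ω = 1)
    (hS : ∀ ω, S ω = S1 ω * D ω + S0 ω * (1 - D ω))
    (hY : ∀ ω, Y ω = S ω * (Y1 ω * D ω + Y0 ω * (1 - D ω)))
    -- Assumption 1 (independent assignment)
    (hIndep : IndepFun (fun ω => (Y1 ω, Y0 ω, S1 ω, S0 ω)) D μ)
    -- Assumption 3(i)
    (ϑL : ℝ) (hϑL : ϑL ∈ Set.Ioc (0 : ℝ) 1)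
    (hSM1 : ϑL ≤ cpr μ {ω | S0 ω = 1} {ω | S1 ω = 1})
    -- positivity conditions
    (hD1 : 0 < pr μ {ω | D ω = 1}) (hD1' : pr μ {ω | D ω = 1} < 1)
    (hS0pos : 0 < pr μ {ω | S0 ω = 1}) (hS0neg : 0 < pr μ {ω | S0 ω = 0})
    (hlt : cpr μ {ω | D ω = 0} {ω | S ω = 1} < 1) :
    cpr μ {ω | S0 ω = 0} {ω | S1 ω = 1}
      ≤ (cpr μ {ω | D ω = 1} {ω | S ω = 1}
          - ϑL * cpr μ {ω | D ω = 0} {ω | S ω = 1})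
        / (1 - cpr μ {ω | D ω = 0} {ω | S ω = 1}) := by
  have hI1 : IndepFun S1 D μ :=
    hIndep.comp (φ := fun x : ℝ × ℝ × ℝ × ℝ => x.2.2.1) (ψ := id) (by fun_prop) measurable_id
  have hI0 : IndepFun S0 D μ :=
    hIndep.comp (φ := fun x : ℝ × ℝ × ℝ × ℝ => x.2.2.2) (ψ := id) (by fun_prop) measurable_id
  have m1 : MeasurableSet ({1} : Set ℝ) := measurableSet_singleton 1
  have m0 : MeasurableSet ({0} : Set ℝ) := measurableSet_singleton 0
  have mS0 : MeasurableSet {ω | S0 ω = 1} := hS0m m1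
  have mD : MeasurableSet {ω | D ω = 1} := hDm m1
  have e1 : pr μ ({ω | D ω = 1} ∩ {ω | S ω = 1})
      = pr μ {ω | S1 ω = 1} * pr μ {ω | D ω = 1} := by
    have h := hI1.measure_inter_preimage_eq_mul {1} {1} m1 m1
    have hs : {ω | D ω = 1} ∩ {ω | S ω = 1} = S1 ⁻¹' {1} ∩ D ⁻¹' {1} := by
      ext ω
      simp only [mem_inter_iff, mem_setOf_eq, mem_preimage, mem_singleton_iff, hS]
      constructor
      · rintro ⟨h1, h2⟩
        rw [h1] at h2
        exact ⟨by linarith, h1⟩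
      · rintro ⟨h1, h2⟩
        exact ⟨h2, by rw [h1, h2]; ring⟩
    unfold pr
    rw [hs, h, ENNReal.toReal_mul]
    rfl
  have e0 : pr μ ({ω | D ω = 0} ∩ {ω | S ω = 1})
      = pr μ {ω | S0 ω = 1} * pr μ {ω | D ω = 0} := by
    have h := hI0.measure_inter_preimage_eq_mul {1} {0} m1 m0
    have hs : {ω | D ω = 0} ∩ {ω | S ω = 1} = S0 ⁻¹' {1} ∩ D ⁻¹' {0} := by
      ext ω
      simp only [mem_inter_iff, mem_setOf_eq, mem_preimage, mem_singleton_iff, hS]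
      constructor
      · rintro ⟨h1, h2⟩
        rw [h1] at h2
        exact ⟨by linarith, h1⟩
      · rintro ⟨h1, h2⟩
        exact ⟨h2, by rw [h1, h2]; ring⟩
    unfold pr
    rw [hs, h, ENNReal.toReal_mul]
    rfl
  have cD : {ω | D ω = 0} = {ω | D ω = 1}ᶜ := by
    ext ω
    rcases hDv ω with h | h <;> simp [h]
  have cS : {ω | S0 ω = 0} = {ω | S0 ω = 1}ᶜ := by
    ext ω
    rcases hS0v ω with h | h <;> simp [h]
  have pD : pr μ {ω | D ω = 0} = 1 - pr μ {ω | D ω = 1} := by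
    rw [cD]; exact probReal_compl_eq_one_sub mD
  have pS : pr μ {ω | S0 ω = 0} = 1 - pr μ {ω | S0 ω = 1} := by
    rw [cS]; exact probReal_compl_eq_one_sub mS0
  have tot : pr μ ({ω | S0 ω = 1} ∩ {ω | S1 ω = 1}) + pr μ ({ω | S0 ω = 0} ∩ {ω | S1 ω = 1})
      = pr μ {ω | S1 ω = 1} := by
    rw [cS, inter_comm, inter_comm _ {ω | S1 ω = 1}, ← diff_eq]
    exact measureReal_inter_add_diff mS0
  have hD0 : 0 < pr μ {ω | D ω = 0} := by linarith
  have c1 : cpr μ {ω | D ω = 1} {ω | S ω = 1} = pr μ {ω | S1 ω = 1} := by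
    unfold cpr
    rw [e1, mul_div_cancel_right₀ _ hD1.ne']
  have c0 : cpr μ {ω | D ω = 0} {ω | S ω = 1} = pr μ {ω | S0 ω = 1} := by
    unfold cpr
    rw [e0, mul_div_cancel_right₀ _ hD0.ne']
  rw [c1, c0, ← pS]
  unfold cpr at hSM1 ⊢
  rw [le_div_iff₀ hS0pos] at hSM1
  exact div_le_div_of_nonneg_right (by linarith) hS0neg.le

end
end

section
/- Fréchet lower bound on the monotone-selection probability. In the sample selection model with Assumption 1, if 0 < P(D=1) < 1, P(S=1|D=0) > 0 and P(S=1|D=1) > 0, then P(S₁=1 | S₀=1) ≥ ϑ_F := 1 + 1/q₀ − 1/α₀, where α₀ := P(S=1|D=0) and q₀ := P(S=1|D=0)/P(S=1|D=1). -/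
open MeasureTheory ProbabilityTheory Set

noncomputable section

variable {Ω : Type*} [MeasurableSpace Ω]

/-- **Fréchet lower bound on the monotone-selection probability.** Under Assumption 1,
`P(S₁=1 | S₀=1) ≥ ϑ_F = 1 + 1/q₀ − 1/α₀`. -/
theorem frechet_lower_bound
    (μ : Measure Ω) [IsProbabilityMeasure μ]
    (Y1 Y0 S1 S0 D S Y : Ω → ℝ)
    (hY1m : Measurable Y1) (hY0m : Measurable Y0)
    (hS1m : Measurable S1) (hS0m : Measurable S0) (hDm : Measurable D)
    (hS1v : ∀ ω, S1 ω = 0 ∨ S1 ω = 1) (hS0v : ∀ ω, S0 ω = 0 ∨ S0 ω = 1)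
    (hDv : ∀ ω, D ω = 0 ∨ D ω = 1)
    (hS : ∀ ω, S ω = S1 ω * D ω + S0 ω * (1 - D ω))
    (hY : ∀ ω, Y ω = S ω * (Y1 ω * D ω + Y0 ω * (1 - D ω)))
    -- Assumption 1 (independent assignment)
    (hIndep : IndepFun (fun ω => (Y1 ω, Y0 ω, S1 ω, S0 ω)) D μ)
    -- positivity conditions
    (hD1 : 0 < pr μ {ω | D ω = 1}) (hD1' : pr μ {ω | D ω = 1} < 1)
    (hSD0 : 0 < cpr μ {ω | D ω = 0} {ω | S ω = 1})
    (hSD1 : 0 < cpr μ {ω | D ω = 1} {ω | S ω = 1})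
    (α0 q0 : ℝ)
    (hα0 : α0 = cpr μ {ω | D ω = 0} {ω | S ω = 1})
    (hq0 : q0 = cpr μ {ω | D ω = 0} {ω | S ω = 1} / cpr μ {ω | D ω = 1} {ω | S ω = 1}) :
    1 + 1 / q0 - 1 / α0 ≤ cpr μ {ω | S0 ω = 1} {ω | S1 ω = 1} := by
  have key : ∀ (T : Ω → ℝ) (d : ℝ), IndepFun T D μ → Measurable T →
      0 < cpr μ {ω | D ω = d} {ω | S ω = 1} → (∀ ω, D ω = d → S ω = T ω) →
      cpr μ {ω | D ω = d} {ω | S ω = 1} = pr μ {ω | T ω = 1} := by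
    intro T d hi hT hpos hST
    have hset : {ω | D ω = d} ∩ {ω | S ω = 1} = T ⁻¹' {1} ∩ D ⁻¹' {d} := by
      ext ω
      simp only [mem_inter_iff, mem_setOf_eq, mem_preimage, mem_singleton_iff]
      constructor
      · rintro ⟨h1, h2⟩
        exact ⟨by rw [← hST ω h1]; exact h2, h1⟩
      · rintro ⟨h1, h2⟩
        exact ⟨h2, by rw [hST ω h2]; exact h1⟩
    have hm := hi.measure_inter_preimage_eq_mul {1} {d}
      (measurableSet_singleton _) (measurableSet_singleton _)
    have hne : pr μ {ω | D ω = d} ≠ 0 := by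
      intro h0
      simp [cpr, h0] at hpos
    unfold cpr
    rw [div_eq_iff hne, hset]
    unfold pr
    rw [hm, ENNReal.toReal_mul]
    rfl
  have i1 : IndepFun S1 D μ :=
    hIndep.comp (φ := fun p : ℝ × ℝ × ℝ × ℝ => p.2.2.1) (ψ := id) (by fun_prop) measurable_id
  have i0 : IndepFun S0 D μ :=
    hIndep.comp (φ := fun p : ℝ × ℝ × ℝ × ℝ => p.2.2.2) (ψ := id) (by fun_prop) measurable_id
  have k1 := key S1 1 i1 hS1m hSD1 (fun ω h => by rw [hS, h]; ring)
  have k0 := key S0 0 i0 hS0m hSD0 (fun ω h => by rw [hS, h]; ring)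
  rw [k0] at hα0 hq0 hSD0
  rw [k1] at hq0 hSD1
  have hA : MeasurableSet {ω | S1 ω = 1} := hS1m (measurableSet_singleton 1)
  have hu : pr μ ({ω | S0 ω = 1} ∪ {ω | S1 ω = 1}) + pr μ ({ω | S0 ω = 1} ∩ {ω | S1 ω = 1})
      = pr μ {ω | S0 ω = 1} + pr μ {ω | S1 ω = 1} :=
    measureReal_union_add_inter hA
  have hle : pr μ ({ω | S0 ω = 1} ∪ {ω | S1 ω = 1}) ≤ 1 := measureReal_le_one
  rw [hα0, hq0]
  unfold cpr
  rw [one_div_div, le_div_iff₀ hSD0]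
  have : (1 + pr μ {ω | S1 ω = 1} / pr μ {ω | S0 ω = 1} - 1 / pr μ {ω | S0 ω = 1})
      * pr μ {ω | S0 ω = 1} = pr μ {ω | S0 ω = 1} + pr μ {ω | S1 ω = 1} - 1 := by
    field_simp
  linarith


end
end

section
/- Mixture decomposition of the observed treated-arm outcome distribution. In the sample selection model with Assumption 1, if P(D=1) > 0, P(S₀=0, S₁=1) > 0 and P(S₀=1, S₁=1) > 0, then for every y ∈ ℝ: P(Y ≤ y | D=1, S=1) = p₀ · P(Y₁* ≤ y | S₀=0, S₁=1) + (1−p₀) · P(Y₁* ≤ y | S₀=1, S₁=1), where p₀ := P(S₀=0, S₁=1)/P(S₁=1). -/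
open MeasureTheory ProbabilityTheory Set

noncomputable section

variable {Ω : Type*} [MeasurableSpace Ω]

/-- **Mixture decomposition of the observed treated-arm outcome distribution.**
Under Assumption 1, the conditional CDF of `Y` given `{D=1, S=1}` is the `p₀`-mixture
of the conditional CDFs of `Y₁*` for the strata `{S₀=0, S₁=1}` and `{S₀=1, S₁=1}`. -/
theorem treated_arm_mixture_decomposition
    (μ : Measure Ω) [IsProbabilityMeasure μ]
    (Y1 Y0 S1 S0 D S Y : Ω → ℝ)
    (hY1m : Measurable Y1) (hY0m : Measurable Y0)
    (hS1m : Measurable S1) (hS0m : Measurable S0) (hDm : Measurable D)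
    (hS1v : ∀ ω, S1 ω = 0 ∨ S1 ω = 1) (hS0v : ∀ ω, S0 ω = 0 ∨ S0 ω = 1)
    (hDv : ∀ ω, D ω = 0 ∨ D ω = 1)
    (hS : ∀ ω, S ω = S1 ω * D ω + S0 ω * (1 - D ω))
    (hY : ∀ ω, Y ω = S ω * (Y1 ω * D ω + Y0 ω * (1 - D ω)))
    -- Assumption 1 (independent assignment)
    (hIndep : IndepFun (fun ω => (Y1 ω, Y0 ω, S1 ω, S0 ω)) D μ)
    -- positivity conditions
    (hD1 : 0 < pr μ {ω | D ω = 1})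
    (h01 : 0 < pr μ {ω | S0 ω = 0 ∧ S1 ω = 1})
    (h11 : 0 < pr μ {ω | S0 ω = 1 ∧ S1 ω = 1})
    (p0 : ℝ) (hp0 : p0 = pr μ {ω | S0 ω = 0 ∧ S1 ω = 1} / pr μ {ω | S1 ω = 1}) :
    ∀ y : ℝ, cpr μ {ω | D ω = 1 ∧ S ω = 1} {ω | Y ω ≤ y}
      = p0 * cpr μ {ω | S0 ω = 0 ∧ S1 ω = 1} {ω | Y1 ω ≤ y}
        + (1 - p0) * cpr μ {ω | S0 ω = 1 ∧ S1 ω = 1} {ω | Y1 ω ≤ y} := by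
  intro y
  have hp : ∀ A B : Set Ω, MeasurableSet B → Disjoint A B → pr μ (A ∪ B) = pr μ A + pr μ B := by
    intro A B hB hd
    unfold pr
    rw [measure_union hd hB, ENNReal.toReal_add (measure_ne_top _ _) (measure_ne_top _ _)]
  have hi : ∀ T : Set (ℝ × ℝ × ℝ × ℝ), MeasurableSet T →
      pr μ ({ω | (Y1 ω, Y0 ω, S1 ω, S0 ω) ∈ T} ∩ {ω | D ω = 1})
        = pr μ {ω | (Y1 ω, Y0 ω, S1 ω, S0 ω) ∈ T} * pr μ {ω | D ω = 1} := by
    intro T hT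
    have h := hIndep.measure_inter_preimage_eq_mul T {1} hT (measurableSet_singleton 1)
    unfold pr
    rw [← ENNReal.toReal_mul]
    exact congrArg ENNReal.toReal h
  have hm0 : MeasurableSet {ω | S0 ω = 1 ∧ S1 ω = 1} :=
    (measurableSet_eq_fun hS0m measurable_const).inter (measurableSet_eq_fun hS1m measurable_const)
  have hmY : MeasurableSet {ω | Y1 ω ≤ y} := measurableSet_le hY1m measurable_const
  have hT1 : MeasurableSet {t : ℝ × ℝ × ℝ × ℝ | t.2.2.1 = 1} :=
    measurableSet_eq_fun (by fun_prop) measurable_const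
  have hT2 : MeasurableSet {t : ℝ × ℝ × ℝ × ℝ | t.1 ≤ y} :=
    measurableSet_le (by fun_prop) measurable_const
  have e1 := hi _ hT1
  have e2 := hi _ (hT1.inter hT2)
  have hdis : Disjoint {ω | S0 ω = 0 ∧ S1 ω = 1} {ω | S0 ω = 1 ∧ S1 ω = 1} := by
    rw [Set.disjoint_left]
    rintro ω ⟨h, _⟩ ⟨h', _⟩
    rw [h] at h'
    exact zero_ne_one h'
  have u1 := hp _ _ hm0 hdis
  have u2 := hp _ _ (hm0.inter hmY)
    (hdis.mono inter_subset_left (inter_subset_left (t := {ω | Y1 ω ≤ y})) :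
      Disjoint ({ω | S0 ω = 0 ∧ S1 ω = 1} ∩ {ω | Y1 ω ≤ y}) _)
  have v1 : {ω | S0 ω = 0 ∧ S1 ω = 1} ∪ {ω | S0 ω = 1 ∧ S1 ω = 1} = {ω | S1 ω = 1} := by
    ext ω
    have := hS0v ω
    simp only [mem_union, mem_setOf_eq]
    tauto
  rw [← union_inter_distrib_right, v1] at u2
  rw [v1] at u1
  have w1 : {ω | D ω = 1 ∧ S ω = 1} = {ω | S1 ω = 1} ∩ {ω | D ω = 1} := by
    ext ω
    simp only [mem_inter_iff, mem_setOf_eq]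
    constructor
    · rintro ⟨h, h'⟩
      have := hS ω
      rw [h, h'] at this
      exact ⟨by linarith, h⟩
    · rintro ⟨h, h'⟩
      refine ⟨h', ?_⟩
      rw [hS ω, h, h']
      norm_num
  have w2 : {ω | D ω = 1 ∧ S ω = 1} ∩ {ω | Y ω ≤ y}
      = ({ω | S1 ω = 1} ∩ {ω | Y1 ω ≤ y}) ∩ {ω | D ω = 1} := by
    rw [w1]
    ext ω
    simp only [mem_inter_iff, mem_setOf_eq]
    have key : S1 ω = 1 → D ω = 1 → Y ω = Y1 ω := by
      intro h h'
      rw [hY ω, hS ω, h, h']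
      ring
    constructor
    · rintro ⟨⟨h, h'⟩, h2⟩
      exact ⟨⟨h, key h h' ▸ h2⟩, h'⟩
    · rintro ⟨⟨h, h2⟩, h'⟩
      exact ⟨⟨h, h'⟩, (key h h').symm ▸ h2⟩
  have e1' : pr μ ({ω | S1 ω = 1} ∩ {ω | D ω = 1}) = pr μ {ω | S1 ω = 1} * pr μ {ω | D ω = 1} := e1
  have e2' : pr μ (({ω | S1 ω = 1} ∩ {ω | Y1 ω ≤ y}) ∩ {ω | D ω = 1})
      = pr μ ({ω | S1 ω = 1} ∩ {ω | Y1 ω ≤ y}) * pr μ {ω | D ω = 1} := e2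
  unfold cpr
  rw [w2, w1, e1', e2', hp0, u1, u2]
  generalize pr μ {ω | S0 ω = 0 ∧ S1 ω = 1} = a at *
  generalize pr μ {ω | S0 ω = 1 ∧ S1 ω = 1} = b at *
  have hab : a + b ≠ 0 := by positivity
  have ha := h01.ne'
  have hb := h11.ne'
  have hd := hD1.ne'
  have h1 : 1 - a / (a + b) = b / (a + b) := by field_simp; ring
  rw [h1]
  field_simp

end
end

section
/- Point identification of the control-arm always-taker mean. In the sample selection model with Assumption 1 and Assumption 3(ii) ((Y₁*, Y₀*) conditionally independent of S₁ given the event {S₀=1}), if Y₀* is integrable, P(D=0) > 0, P(S₀=1) > 0 and P(S₀=1, S₁=1) > 0, then E[Y₀* | S₀=1, S₁=1] = E[Y₀* | S₀=1] = E[Y | D=0, S=1]. -/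
open MeasureTheory ProbabilityTheory Set

noncomputable section

variable {Ω : Type*} [MeasurableSpace Ω]

/-- Integral over an event determined by an independent variable factorizes. -/
theorem setIntegral_indep_aux (ν : Measure Ω) (X T : Ω → ℝ) (hX : Measurable X)
    (hT : Measurable T) (h : IndepFun X T ν) (t : ℝ) :
    ∫ ω in {ω | T ω = t}, X ω ∂ν = (∫ ω, X ω ∂ν) * ν.real {ω | T ω = t} := by
  have hB : MeasurableSet {ω | T ω = t} := hT (measurableSet_singleton t)
  have hg : Measurable (({t} : Set ℝ).indicator (fun _ => (1 : ℝ))) :=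
    measurable_const.indicator (measurableSet_singleton t)
  have h2 : IndepFun X (fun ω => ({t} : Set ℝ).indicator (fun _ => (1 : ℝ)) (T ω)) ν :=
    h.comp measurable_id hg
  have h3 := h2.integral_fun_mul_eq_mul_integral hX.aestronglyMeasurable
    (hg.comp hT).aestronglyMeasurable
  have e1 : (fun ω => ({t} : Set ℝ).indicator (fun _ => (1 : ℝ)) (T ω))
      = {ω | T ω = t}.indicator (fun _ => (1 : ℝ)) := by
    funext ω
    simp [Set.indicator]
  have e2 : (fun ω => X ω * ({t} : Set ℝ).indicator (fun _ => (1 : ℝ)) (T ω))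
      = {ω | T ω = t}.indicator X := by
    funext ω
    simp [Set.indicator]
  rw [e1, e2, integral_indicator hB, integral_indicator hB] at h3
  rw [h3]
  simp

/-- **Point identification of the control-arm always-taker mean.** Under Assumption 1
and Assumption 3(ii), `E[Y₀* | S₀=1, S₁=1] = E[Y₀* | S₀=1] = E[Y | D=0, S=1]`. -/
theorem control_arm_mean_identification
    (μ : Measure Ω) [IsProbabilityMeasure μ]
    (Y1 Y0 S1 S0 D S Y : Ω → ℝ)
    (hY1m : Measurable Y1) (hY0m : Measurable Y0)
    (hS1m : Measurable S1) (hS0m : Measurable S0) (hDm : Measurable D)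
    (hS1v : ∀ ω, S1 ω = 0 ∨ S1 ω = 1) (hS0v : ∀ ω, S0 ω = 0 ∨ S0 ω = 1)
    (hDv : ∀ ω, D ω = 0 ∨ D ω = 1)
    (hS : ∀ ω, S ω = S1 ω * D ω + S0 ω * (1 - D ω))
    (hY : ∀ ω, Y ω = S ω * (Y1 ω * D ω + Y0 ω * (1 - D ω)))
    -- Assumption 1 (independent assignment)
    (hIndep : IndepFun (fun ω => (Y1 ω, Y0 ω, S1 ω, S0 ω)) D μ)
    (hY0i : Integrable Y0 μ)
    -- Assumption 3(ii)
    (hSM2 : IndepFun (fun ω => (Y1 ω, Y0 ω)) S1 (μ[|{ω | S0 ω = 1}]))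
    -- positivity conditions
    (hD0 : 0 < pr μ {ω | D ω = 0})
    (hS0pos : 0 < pr μ {ω | S0 ω = 1})
    (hAT : 0 < pr μ {ω | S0 ω = 1 ∧ S1 ω = 1}) :
    cexp μ Y0 {ω | S0 ω = 1 ∧ S1 ω = 1} = cexp μ Y0 {ω | S0 ω = 1} ∧
      cexp μ Y0 {ω | S0 ω = 1} = cexp μ Y {ω | D ω = 0 ∧ S ω = 1} := by
  have hA : MeasurableSet {ω | S0 ω = 1} := hS0m (measurableSet_singleton 1)
  have hB : MeasurableSet {ω | S1 ω = 1} := hS1m (measurableSet_singleton 1)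
  have hC : MeasurableSet {ω | D ω = 0} := hDm (measurableSet_singleton 0)
  have eAB : {ω | S0 ω = 1 ∧ S1 ω = 1} = {ω | S1 ω = 1} ∩ {ω | S0 ω = 1} := by
    ext ω
    simp [and_comm]
  constructor
  · have hi : IndepFun Y0 S1 (μ[|{ω | S0 ω = 1}]) := hSM2.comp measurable_snd measurable_id
    have h := setIntegral_indep_aux _ Y0 S1 hY0m hS1m hi 1
    rw [measureReal_def, ProbabilityTheory.cond_apply hA, Set.inter_comm, ← eAB] at h
    rw [ProbabilityTheory.cond, Measure.restrict_smul, Measure.restrict_restrict hB, ← eAB,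
      integral_smul_measure, integral_smul_measure, ENNReal.toReal_mul, ENNReal.toReal_inv] at h
    unfold cexp
    unfold pr at *
    simp only [smul_eq_mul] at h
    field_simp at h ⊢
    linarith
  · have eS : (fun ω => S0 ω * Y0 ω) = {ω | S0 ω = 1}.indicator Y0 := by
      funext ω
      rcases hS0v ω with h | h <;> simp [h, Set.indicator]
    have eS' : (fun ω => S0 ω) = {ω | S0 ω = 1}.indicator (fun _ => (1 : ℝ)) := by
      funext ω
      rcases hS0v ω with h | h <;> simp [h, Set.indicator]
    have hi1 : IndepFun (fun ω => S0 ω * Y0 ω) D μ :=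
      hIndep.comp (φ := fun p : ℝ × ℝ × ℝ × ℝ => p.2.2.2 * p.2.1) (by fun_prop) measurable_id
    have hi2 : IndepFun (fun ω => S0 ω) D μ :=
      hIndep.comp (φ := fun p : ℝ × ℝ × ℝ × ℝ => p.2.2.2) (by fun_prop) measurable_id
    have h1 := setIntegral_indep_aux μ (fun ω => S0 ω * Y0 ω) D (hS0m.mul hY0m) hDm hi1 0
    have h2 := setIntegral_indep_aux μ _ D hS0m hDm hi2 0
    have eCA : {ω | D ω = 0 ∧ S ω = 1} = {ω | D ω = 0} ∩ {ω | S0 ω = 1} := by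
      ext ω
      simp only [Set.mem_ofPred_eq, Set.mem_inter_iff]
      refine and_congr_right fun h => ?_
      simp [hS, h]
    have h3 : ∫ ω in {ω | D ω = 0} ∩ {ω | S0 ω = 1}, Y ω ∂μ
        = ∫ ω in {ω | D ω = 0} ∩ {ω | S0 ω = 1}, Y0 ω ∂μ := by
      refine setIntegral_congr_fun (hC.inter hA) ?_
      rintro ω ⟨h, h'⟩
      simp only [Set.mem_ofPred_eq] at h h'
      simp [hY, hS, h, h']
    rw [eS, setIntegral_indicator hA, integral_indicator hA] at h1
    rw [eS', setIntegral_indicator hA, integral_indicator hA] at h2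
    simp only [setIntegral_const, smul_eq_mul, mul_one, measureReal_def] at h1 h2
    unfold cexp
    rw [eCA, h3, h1]
    unfold pr at *
    rw [h2]
    field_simp

end
end

section
/- Lower bound on the always-taker share among the treated-and-selected. In the sample selection model with Assumption 1 and Assumption 3(i) (P(S₁=1|S₀=1) ≥ ϑ_L, ϑ_L ∈ (0,1]), if 0 < P(D=1) < 1, P(S=1|D=0) > 0 and P(S=1|D=1) > 0, then P(S₀=1, S₁=1)/P(S₁=1) ≥ ϑ_L·q₀, equivalently p₀ := P(S₀=0, S₁=1)/P(S₁=1) ≤ 1 − ϑ_L·q₀, where q₀ := P(S=1|D=0)/P(S=1|D=1). -/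
open MeasureTheory ProbabilityTheory Set

noncomputable section

variable {Ω : Type*} [MeasurableSpace Ω]

/-- **Lower bound on the always-taker share among the treated-and-selected.** Under
Assumptions 1 and 3(i), `P(S₀=1, S₁=1)/P(S₁=1) ≥ ϑ_L·q₀`, equivalently
`p₀ = P(S₀=0, S₁=1)/P(S₁=1) ≤ 1 − ϑ_L·q₀`. -/
theorem always_taker_share_lower_bound
    (μ : Measure Ω) [IsProbabilityMeasure μ]
    (Y1 Y0 S1 S0 D S Y : Ω → ℝ)
    (hY1m : Measurable Y1) (hY0m : Measurable Y0)
    (hS1m : Measurable S1) (hS0m : Measurable S0) (hDm : Measurable D)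
    (hS1v : ∀ ω, S1 ω = 0 ∨ S1 ω = 1) (hS0v : ∀ ω, S0 ω = 0 ∨ S0 ω = 1)
    (hDv : ∀ ω, D ω = 0 ∨ D ω = 1)
    (hS : ∀ ω, S ω = S1 ω * D ω + S0 ω * (1 - D ω))
    (hY : ∀ ω, Y ω = S ω * (Y1 ω * D ω + Y0 ω * (1 - D ω)))
    -- Assumption 1 (independent assignment)
    (hIndep : IndepFun (fun ω => (Y1 ω, Y0 ω, S1 ω, S0 ω)) D μ)
    -- Assumption 3(i)
    (ϑL : ℝ) (hϑL : ϑL ∈ Set.Ioc (0 : ℝ) 1)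
    (hSM1 : ϑL ≤ cpr μ {ω | S0 ω = 1} {ω | S1 ω = 1})
    -- positivity conditions
    (hD1 : 0 < pr μ {ω | D ω = 1}) (hD1' : pr μ {ω | D ω = 1} < 1)
    (hSD0 : 0 < cpr μ {ω | D ω = 0} {ω | S ω = 1})
    (hSD1 : 0 < cpr μ {ω | D ω = 1} {ω | S ω = 1})
    (q0 : ℝ)
    (hq0 : q0 = cpr μ {ω | D ω = 0} {ω | S ω = 1} / cpr μ {ω | D ω = 1} {ω | S ω = 1}) :
    ϑL * q0 ≤ pr μ {ω | S0 ω = 1 ∧ S1 ω = 1} / pr μ {ω | S1 ω = 1} ∧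
      pr μ {ω | S0 ω = 0 ∧ S1 ω = 1} / pr μ {ω | S1 ω = 1} ≤ 1 - ϑL * q0 := by
  have hI1 : IndepFun S1 D μ := hIndep.comp
    (φ := fun p : ℝ × ℝ × ℝ × ℝ => p.2.2.1) (ψ := id) (by fun_prop) measurable_id
  have hI0 : IndepFun S0 D μ := hIndep.comp
    (φ := fun p : ℝ × ℝ × ℝ × ℝ => p.2.2.2) (ψ := id) (by fun_prop) measurable_id
  have key : ∀ (T : Ω → ℝ) (d : ℝ), IndepFun T D μ →
      pr μ ({ω | D ω = d} ∩ {ω | T ω = 1}) = pr μ {ω | T ω = 1} * pr μ {ω | D ω = d} := by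
    intro T d hT
    have h := hT.measure_inter_preimage_eq_mul {1} {d}
      (measurableSet_singleton _) (measurableSet_singleton _)
    have h' : μ ({ω | T ω = 1} ∩ {ω | D ω = d}) = μ {ω | T ω = 1} * μ {ω | D ω = d} := h
    unfold pr
    rw [Set.inter_comm, h', ENNReal.toReal_mul]
  have hD0 : pr μ {ω | D ω = 0} ≠ 0 := by
    intro h
    unfold cpr at hSD0
    rw [h, div_zero] at hSD0
    exact lt_irrefl _ hSD0
  have e1 : cpr μ {ω | D ω = 1} {ω | S ω = 1} = pr μ {ω | S1 ω = 1} := by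
    have hset : {ω | D ω = 1} ∩ {ω | S ω = 1} = {ω | D ω = 1} ∩ {ω | S1 ω = 1} := by
      ext ω
      simp only [Set.mem_inter_iff, Set.mem_setOf_eq]
      refine and_congr_right fun h => ?_
      rw [hS, h]; simp
    unfold cpr
    rw [hset, key S1 1 hI1, mul_div_assoc, div_self hD1.ne', mul_one]
  have e0 : cpr μ {ω | D ω = 0} {ω | S ω = 1} = pr μ {ω | S0 ω = 1} := by
    have hset : {ω | D ω = 0} ∩ {ω | S ω = 1} = {ω | D ω = 0} ∩ {ω | S0 ω = 1} := by
      ext ω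
      simp only [Set.mem_inter_iff, Set.mem_setOf_eq]
      refine and_congr_right fun h => ?_
      rw [hS, h]; simp
    unfold cpr
    rw [hset, key S0 0 hI0, mul_div_assoc, div_self hD0, mul_one]
  rw [e1] at hSD1 hq0
  rw [e0] at hSD0 hq0
  have hb : ϑL * pr μ {ω | S0 ω = 1} ≤ pr μ {ω | S0 ω = 1 ∧ S1 ω = 1} := by
    unfold cpr at hSM1
    exact (le_div_iff₀ hSD0).1 hSM1
  have hsum : pr μ {ω | S1 ω = 1}
      = pr μ {ω | S0 ω = 1 ∧ S1 ω = 1} + pr μ {ω | S0 ω = 0 ∧ S1 ω = 1} := by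
    have hu : {ω | S1 ω = 1} = {ω | S0 ω = 1 ∧ S1 ω = 1} ∪ {ω | S0 ω = 0 ∧ S1 ω = 1} := by
      ext ω
      have := hS0v ω
      simp only [Set.mem_union, Set.mem_setOf_eq]
      tauto
    have hd : Disjoint {ω | S0 ω = 1 ∧ S1 ω = 1} {ω | S0 ω = 0 ∧ S1 ω = 1} := by
      rw [Set.disjoint_left]
      rintro ω ⟨h, -⟩ ⟨h', -⟩
      rw [h] at h'
      exact one_ne_zero h'
    have hm : MeasurableSet {ω | S0 ω = 0 ∧ S1 ω = 1} :=
      (hS0m (measurableSet_singleton 0)).inter (hS1m (measurableSet_singleton 1))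
    unfold pr
    rw [← ENNReal.toReal_add (measure_ne_top _ _) (measure_ne_top _ _),
      ← measure_union hd hm, ← hu]
  have hmain : ϑL * q0 ≤ pr μ {ω | S0 ω = 1 ∧ S1 ω = 1} / pr μ {ω | S1 ω = 1} := by
    rw [hq0, ← mul_div_assoc]
    exact div_le_div_of_nonneg_right hb hSD1.le
  refine ⟨hmain, ?_⟩
  have h1 : pr μ {ω | S0 ω = 1 ∧ S1 ω = 1} / pr μ {ω | S1 ω = 1}
      + pr μ {ω | S0 ω = 0 ∧ S1 ω = 1} / pr μ {ω | S1 ω = 1} = 1 := by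
    rw [← add_div, ← hsum, div_self hSD1.ne']
  linarith

end
end

section
/- Quantile bounds on the mean of a mixture component with mean–median coincidence (abstract core of Theorem 2). Let Q, P₀, P₁ be Borel probability measures on ℝ with Q = p·P₀ + (1−p)·P₁, where p ∈ [0, 1−c] for some c ∈ (0,1], and suppose the CDF of Q is continuous and strictly increasing, with r-quantile y_r := inf{t : Q((−∞,t]) ≥ r}. If P₁ has finite mean μ₁ and μ₁ is a median of P₁ (P₁((−∞, μ₁]) ≥ 1/2 and P₁([μ₁, ∞)) ≥ 1/2), then y_{c/2} ≤ μ₁ ≤ y_{1−c/2}. -/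
open MeasureTheory ProbabilityTheory Set

noncomputable section

variable {Ω : Type*} [MeasurableSpace Ω]

/-- **Quantile bounds on the mean of a mixture component with mean–median coincidence.**
If `Q = p·P₀ + (1−p)·P₁` with `p ≤ 1 − c`, and the mean `μ₁` of `P₁` is also a median
of `P₁`, then `y_{c/2} ≤ μ₁ ≤ y_{1−c/2}` where `y_r` is the `r`-quantile of `Q`. -/
theorem mixture_component_mean_quantile_bounds
    (Q P0 P1 : Measure ℝ)
    [IsProbabilityMeasure Q] [IsProbabilityMeasure P0] [IsProbabilityMeasure P1]
    (p c : ℝ) (hc : c ∈ Set.Ioc (0 : ℝ) 1) (hp : p ∈ Set.Icc 0 (1 - c))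
    (hmix : Q = ENNReal.ofReal p • P0 + ENNReal.ofReal (1 - p) • P1)
    (cdfQ : ℝ → ℝ) (hcdfQ : ∀ t, cdfQ t = (Q (Set.Iic t)).toReal)
    (hQcont : Continuous cdfQ) (hQmono : StrictMono cdfQ)
    (yq : ℝ → ℝ) (hyq : ∀ r, yq r = sInf {t : ℝ | r ≤ cdfQ t})
    -- P₁ has finite mean μ₁ which is also a median of P₁
    (hint : Integrable (fun x : ℝ => x) P1)
    (μ1 : ℝ) (hμ1 : μ1 = ∫ x, x ∂P1)
    (hmed1 : 1 / 2 ≤ (P1 (Set.Iic μ1)).toReal)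
    (hmed2 : 1 / 2 ≤ (P1 (Set.Ici μ1)).toReal) :
    yq (c / 2) ≤ μ1 ∧ μ1 ≤ yq (1 - c / 2) := by
  have hc0 := hc.1
  have hp0 := hp.1
  have hp1 := hp.2
  have hQ : ∀ A : Set ℝ, (Q A).toReal = p * (P0 A).toReal + (1 - p) * (P1 A).toReal := by
    intro A
    rw [hmix]
    simp only [Measure.coe_add, Measure.coe_smul, Pi.add_apply, Pi.smul_apply, smul_eq_mul]
    rw [ENNReal.toReal_add (ENNReal.mul_ne_top ENNReal.ofReal_ne_top (measure_ne_top _ _))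
      (ENNReal.mul_ne_top ENNReal.ofReal_ne_top (measure_ne_top _ _)),
      ENNReal.toReal_mul, ENNReal.toReal_mul, ENNReal.toReal_ofReal hp0,
      ENNReal.toReal_ofReal (by linarith)]
  have hlow : ∀ A : Set ℝ, 1 / 2 ≤ (P1 A).toReal → c / 2 ≤ (Q A).toReal := by
    intro A hA
    rw [hQ]
    have h1 : 0 ≤ p * (P0 A).toReal := mul_nonneg hp0 ENNReal.toReal_nonneg
    nlinarith
  have hcdf : cdfQ = fun t => cdf Q t := by
    funext t
    rw [hcdfQ, cdf_eq_real, Measure.real]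
  have hbot : Filter.Tendsto cdfQ Filter.atBot (nhds 0) := by
    rw [hcdf]; exact tendsto_cdf_atBot Q
  have htop : Filter.Tendsto cdfQ Filter.atTop (nhds 1) := by
    rw [hcdf]; exact tendsto_cdf_atTop Q
  rw [hyq, hyq]
  constructor
  · apply csInf_le
    · obtain ⟨s, hs⟩ := (hbot.eventually (gt_mem_nhds (show (0 : ℝ) < c / 2 by linarith))).exists
      refine ⟨s, fun t ht => ?_⟩
      exact (hQmono.lt_iff_lt.1 (lt_of_lt_of_le hs ht)).le
    · show c / 2 ≤ cdfQ μ1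
      rw [hcdfQ]
      exact hlow _ hmed1
  · apply le_csInf
    · obtain ⟨s, hs⟩ := (htop.eventually (lt_mem_nhds (show 1 - c / 2 < 1 by linarith))).exists
      exact ⟨s, le_of_lt hs⟩
    · intro t ht
      by_contra hlt
      obtain ⟨s, hts, hs⟩ := exists_between (not_le.1 hlt)
      have h1 := hQmono hts
      have h2 : 1 - c / 2 ≤ cdfQ t := ht
      have h3 := hlow _ hmed2
      have h4 : Q.real (Set.Iic s ∪ Set.Ici μ1) = Q.real (Set.Iic s) + Q.real (Set.Ici μ1) := by
        apply measureReal_union _ measurableSet_Ici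
        exact Set.disjoint_left.2 fun x hx hy =>
          absurd (lt_of_le_of_lt hx hs) (not_lt.2 hy)
      have h5 : Q.real (Set.Iic s ∪ Set.Ici μ1) ≤ 1 := measureReal_le_one
      have h6 := hcdfQ s
      simp only [Measure.real] at h4 h5
      linarith

end
end

section
/- Trimmed mean versus interior quantile under a one-sided density domination condition (core of Corollary 1). Let Y be an integrable real random variable whose law has a density f with respect to Lebesgue measure, let c ∈ (0,1), and let y_r := inf{t : P(Y ≤ t) ≥ r} denote the r-quantile. (a) If f(y_{1−c/2} − a) ≥ f(y_{1−c/2} + a) for almost every a ≥ 0, then E[Y | Y ≥ y_{1−c}] ≥ y_{1−c/2}. (b) If f(y_{c/2} − a) ≤ f(y_{c/2} + a) for almost every a ≥ 0, then E[Y | Y ≤ y_c] ≤ y_{c/2}. -/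
open MeasureTheory ProbabilityTheory Set

noncomputable section

variable {Ω : Type*} [MeasurableSpace Ω]

theorem core_aux {Ω : Type*} [MeasurableSpace Ω] (μ : Measure Ω) [IsProbabilityMeasure μ]
    (Z : Ω → ℝ) (hZ : Measurable Z) (hZi : Integrable Z μ) (d k : ℝ) (hd : 0 ≤ d)
    (hdom : ∀ A : Set ℝ, MeasurableSet A → A ⊆ Ioi 0 →
      μ {ω | Z ω ∈ A} ≤ μ {ω | - Z ω ∈ A})
    (h1 : μ.real {ω | -d ≤ Z ω ∧ Z ω ≤ 0} = k) (h2 : μ.real {ω | 0 < Z ω} = k) :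
    0 ≤ ∫ ω in {ω | -d ≤ Z ω}, Z ω ∂μ := by
  have mP : MeasurableSet {ω | 0 < Z ω} := measurableSet_lt measurable_const hZ
  have mN : MeasurableSet {ω | Z ω < 0} := measurableSet_lt hZ measurable_const
  have mI : MeasurableSet {ω | -d ≤ Z ω ∧ Z ω ≤ 0} :=
    (measurableSet_le measurable_const hZ).inter (measurableSet_le hZ measurable_const)
  have mI' : MeasurableSet {ω | -d ≤ Z ω} := measurableSet_le measurable_const hZ
  have hZn : Measurable (fun ω => - Z ω) := hZ.neg
  have hle : (μ.restrict {ω | 0 < Z ω}).map Z ≤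
      (μ.restrict {ω | Z ω < 0}).map (fun ω => - Z ω) := by
    refine Measure.le_iff.2 fun A hA => ?_
    rw [Measure.map_apply hZ hA, Measure.map_apply hZn hA,
      Measure.restrict_apply (hZ hA), Measure.restrict_apply (hZn hA)]
    have := hdom (A ∩ Ioi 0) (hA.inter measurableSet_Ioi) inter_subset_right
    convert this using 2
    all_goals (ext ω; simp)
  have mφ : Measurable (fun a : ℝ => max (d - a) 0) := by fun_prop
  have hφi : Integrable (fun ω => max (d + Z ω) 0) μ :=
    ((integrable_const d).add hZi).sup (integrable_const 0)
  have e1 := integral_mono_measure (f := fun a : ℝ => max (d - a) 0) hle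
    (Filter.Eventually.of_forall fun a => le_max_right _ _)
    (by
      rw [integrable_map_measure mφ.aestronglyMeasurable hZn.aemeasurable]
      have := hφi.restrict (s := {ω | Z ω < 0})
      refine this.congr (Filter.Eventually.of_forall fun ω => ?_)
      simp)
  rw [integral_map hZ.aemeasurable mφ.aestronglyMeasurable,
    integral_map hZn.aemeasurable mφ.aestronglyMeasurable] at e1
  have e2 : ∫ ω in {ω | 0 < Z ω}, (d - Z ω) ∂μ ≤ ∫ ω in {ω | 0 < Z ω}, max (d - Z ω) 0 ∂μ := by
    refine integral_mono ((integrable_const d).sub hZi.restrict) ?_ fun ω => le_max_left _ _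
    exact (((integrable_const d).sub hZi).sup (integrable_const 0)).restrict
  have e3 : ∫ ω in {ω | Z ω < 0}, max (d - - Z ω) 0 ∂μ ≤
      ∫ ω in {ω | -d ≤ Z ω ∧ Z ω ≤ 0}, (d + Z ω) ∂μ := by
    rw [← integral_indicator mN, ← integral_indicator mI]
    refine integral_mono ?_ ?_ fun ω => ?_
    · refine (integrable_indicator_iff mN).2 ?_
      have := hφi.restrict (s := {ω | Z ω < 0})
      refine this.congr (Filter.Eventually.of_forall fun ω => ?_)
      simp
    · exact (integrable_indicator_iff mI).2 ((integrable_const d).add hZi).restrict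
    · simp only [indicator_apply, mem_setOf_eq]
      split_ifs with a b b
      · rw [max_eq_left] <;> linarith [b.1]
      · rw [max_eq_right]
        by_contra hh
        exact b ⟨by linarith, a.le⟩
      · linarith [b.1]
      · exact le_rfl
  have e4 := e2.trans (e1.trans e3)
  rw [integral_sub (integrable_const d) hZi.restrict,
    integral_add (integrable_const d) hZi.restrict] at e4
  simp only [integral_const, smul_eq_mul, measureReal_restrict_apply_univ] at e4
  rw [h1, h2] at e4
  have e5 : {ω | -d ≤ Z ω} = {ω | -d ≤ Z ω ∧ Z ω ≤ 0} ∪ {ω | 0 < Z ω} := by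
    ext ω
    simp only [mem_setOf_eq, mem_union]
    constructor
    · intro h
      rcases le_or_gt (Z ω) 0 with h' | h'
      · exact Or.inl ⟨h, h'⟩
      · exact Or.inr h'
    · rintro (h | h)
      · exact h.1
      · linarith
  rw [e5, setIntegral_union _ mP hZi.integrableOn hZi.integrableOn]
  · linarith
  · refine Set.disjoint_left.2 fun ω h h' => ?_
    exact absurd h.2 (not_le.2 h')

theorem dens_aux (g : ℝ → ENNReal) (m : ℝ) (A : Set ℝ) :
    ∫⁻ y in {y | y - m ∈ A}, g y = ∫⁻ a in A, g (m + a) := by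
  have := (measurePreserving_sub_right volume m).setLIntegral_comp_preimage_emb
    (MeasurableEquiv.subRight m).measurableEmbedding (fun a => g (m + a)) A
  simp only [add_sub_cancel, sub_sub_cancel] at this
  exact this

theorem dens_aux2 (g : ℝ → ENNReal) (m : ℝ) (A : Set ℝ) :
    ∫⁻ y in {y | m - y ∈ A}, g y = ∫⁻ a in A, g (m - a) := by
  have := (Measure.measurePreserving_sub_left volume m).setLIntegral_comp_preimage_emb
    (MeasurableEquiv.subLeft m).measurableEmbedding (fun a => g (m - a)) A
  simp only [add_sub_cancel, sub_sub_cancel] at this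
  exact this

/-- **Trimmed mean versus interior quantile under one-sided density domination.**
(a) If the density of `Y` around the `1−c/2` quantile dominates its reflection from the
right, the upper trimmed mean `E[Y | Y ≥ y_{1−c}]` is at least `y_{1−c/2}`.
(b) Symmetrically, `E[Y | Y ≤ y_c] ≤ y_{c/2}` under the mirrored condition. -/
theorem trimmed_mean_vs_quantile
    (μ : Measure Ω) [IsProbabilityMeasure μ]
    (Y : Ω → ℝ) (hYm : Measurable Y) (hYi : Integrable Y μ)
    (f : ℝ → ℝ)
    (hf : Measure.map Y μ = volume.withDensity fun x => ENNReal.ofReal (f x))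
    (c : ℝ) (hc : c ∈ Set.Ioo (0 : ℝ) 1)
    (F : ℝ → ℝ) (yq : ℝ → ℝ)
    (hF : ∀ t, F t = (μ {ω | Y ω ≤ t}).toReal)
    (hyq : ∀ r, yq r = sInf {t : ℝ | r ≤ F t})
    (hFcont : Continuous F) (hFmono : StrictMono F) :
    ((∀ᵐ a ∂(volume.restrict (Set.Ici (0 : ℝ))),
        f (yq (1 - c / 2) + a) ≤ f (yq (1 - c / 2) - a)) →
      yq (1 - c / 2) ≤ cexp μ Y {ω | yq (1 - c) ≤ Y ω}) ∧
    ((∀ᵐ a ∂(volume.restrict (Set.Ici (0 : ℝ))),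
        f (yq (c / 2) - a) ≤ f (yq (c / 2) + a)) →
      cexp μ Y {ω | Y ω ≤ yq c} ≤ yq (c / 2)) := by
  obtain ⟨hc0, hc1⟩ := hc
  have hreal : ∀ t, μ.real {ω | Y ω ≤ t} = F t := fun t => (hF t).symm
  have mle : ∀ t, MeasurableSet {ω | Y ω ≤ t} := fun t => measurableSet_le hYm measurable_const
  -- quantiles
  have hFcdf : ∀ t, F t = cdf (μ.map Y) t := by
    intro t
    have : IsProbabilityMeasure (μ.map Y) := Measure.isProbabilityMeasure_map hYm.aemeasurable
    rw [cdf_eq_real, measureReal_def, Measure.map_apply hYm measurableSet_Iic, hF]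
    rfl
  have hq : ∀ r, 0 < r → r < 1 → F (yq r) = r := by
    intro r h0 h1
    have hb : Filter.Tendsto F Filter.atBot (nhds 0) := by
      rw [show F = cdf (μ.map Y) from funext hFcdf]; exact tendsto_cdf_atBot _
    have ht : Filter.Tendsto F Filter.atTop (nhds 1) := by
      rw [show F = cdf (μ.map Y) from funext hFcdf]; exact tendsto_cdf_atTop _
    obtain ⟨a, ha⟩ := (hb.eventually (gt_mem_nhds h0)).exists
    obtain ⟨b, hb⟩ := (ht.eventually (lt_mem_nhds h1)).exists
    obtain ⟨t, ht⟩ := mem_range_of_exists_le_of_exists_ge hFcont ⟨a, ha.le⟩ ⟨b, hb.le⟩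
    have : {s : ℝ | r ≤ F s} = Ici t := by
      ext s
      simp only [mem_setOf_eq, mem_Ici]
      rw [← ht, hFmono.le_iff_le]
    rw [hyq, this, csInf_Ici, ht]
  have hnull : ∀ t, μ {ω | Y ω = t} = 0 := by
    intro t
    have : μ {ω | Y ω = t} = (μ.map Y) {t} := by
      rw [Measure.map_apply hYm (measurableSet_singleton t)]; rfl
    rw [this, hf]
    exact withDensity_absolutelyContinuous _ _ (by simp)
  have hlt : ∀ t, μ.real {ω | Y ω < t} = F t := by
    intro t
    rw [← hreal]
    refine measureReal_congr ?_
    have : ∀ᵐ ω ∂μ, Y ω ≠ t := by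
      rw [ae_iff]; simpa using hnull t
    filter_upwards [this] with ω hω
    exact propext ⟨fun h => le_of_lt h, fun h => lt_of_le_of_ne h hω⟩
  have hIoc : ∀ s t, s ≤ t → μ.real {ω | s ≤ Y ω ∧ Y ω ≤ t} = F t - F s := by
    intro s t hst
    rw [← hreal t, ← hlt s, ← measureReal_diff _ (measurableSet_lt hYm measurable_const)]
    · congr 1; ext ω; simp [and_comm]
    · intro ω h
      exact le_of_lt (lt_of_lt_of_le h hst)
  have hgt : ∀ t, μ.real {ω | t < Y ω} = 1 - F t := by
    intro t
    rw [← hreal t, ← probReal_compl_eq_one_sub (mle t)]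
    congr 1; ext ω; simp
  have hge : ∀ t, μ.real {ω | t ≤ Y ω} = 1 - F t := by
    intro t
    rw [← hlt t, ← probReal_compl_eq_one_sub (measurableSet_lt hYm measurable_const)]
    congr 1; ext ω; simp
  have hA1 : ∀ (m : ℝ) (A : Set ℝ), MeasurableSet A →
      μ {ω | Y ω - m ∈ A} = ∫⁻ a in A, ENNReal.ofReal (f (m + a)) := by
    intro m A hA
    have mA : MeasurableSet {y : ℝ | y - m ∈ A} := (measurable_id.sub_const m) hA
    rw [← dens_aux (fun y => ENNReal.ofReal (f y)), ← withDensity_apply _ mA, ← hf,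
      Measure.map_apply hYm mA]
    rfl
  have hA2 : ∀ (m : ℝ) (A : Set ℝ), MeasurableSet A →
      μ {ω | m - Y ω ∈ A} = ∫⁻ a in A, ENNReal.ofReal (f (m - a)) := by
    intro m A hA
    have mA : MeasurableSet {y : ℝ | m - y ∈ A} := (measurable_id.const_sub m) hA
    rw [← dens_aux2 (fun y => ENNReal.ofReal (f y)), ← withDensity_apply _ mA, ← hf,
      Measure.map_apply hYm mA]
    rfl
  constructor
  · intro h
    have q1 := hq (1 - c / 2) (by linarith) (by linarith)
    have q2 := hq (1 - c) (by linarith) (by linarith)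
    generalize yq (1 - c / 2) = m at *
    generalize yq (1 - c) = l at *
    have hlm : l ≤ m := by
      rw [← hFmono.le_iff_le]; linarith
    have key := core_aux μ (fun ω => Y ω - m) (hYm.sub_const m) (hYi.sub (integrable_const m))
      (m - l) (c / 2) (by linarith)
      (by
        intro A hA hs
        simp only [neg_sub]
        rw [hA1 m A hA, hA2 m A hA]
        refine lintegral_mono_ae ?_
        filter_upwards [ae_restrict_of_ae_restrict_of_subset
          (hs.trans Ioi_subset_Ici_self) h] with a ha
        exact ENNReal.ofReal_le_ofReal ha)
      (by
        have := hIoc l m hlm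
        rw [q1, q2] at this
        rw [show c / 2 = 1 - c / 2 - (1 - c) by ring, ← this]
        congr 1; ext ω; simp)
      (by
        have := hgt m
        rw [q1] at this
        rw [show c / 2 = 1 - (1 - c / 2) by ring, ← this]
        congr 1; ext ω; simp)
    have hs : {ω | -(m - l) ≤ Y ω - m} = {ω | l ≤ Y ω} := by
      ext ω; simp
    have hp := hge l
    rw [hs, integral_sub hYi.restrict (integrable_const m)] at key
    simp only [integral_const, smul_eq_mul, measureReal_restrict_apply_univ] at key
    rw [hp, q2] at key
    unfold cexp pr
    rw [← measureReal_def, hp, q2, le_div_iff₀ (by linarith)]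
    linarith
  · intro h
    have q1 := hq (c / 2) (by linarith) (by linarith)
    have q2 := hq c (by linarith) (by linarith)
    generalize yq (c / 2) = m at *
    generalize yq c = l at *
    have hlm : m ≤ l := by
      rw [← hFmono.le_iff_le]; linarith
    have key := core_aux μ (fun ω => m - Y ω) (hYm.const_sub m) ((integrable_const m).sub hYi)
      (l - m) (c / 2) (by linarith)
      (by
        intro A hA hs
        simp only [neg_sub]
        rw [hA1 m A hA, hA2 m A hA]
        refine lintegral_mono_ae ?_
        filter_upwards [ae_restrict_of_ae_restrict_of_subset
          (hs.trans Ioi_subset_Ici_self) h] with a ha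
        exact ENNReal.ofReal_le_ofReal ha)
      (by
        have := hIoc m l hlm
        rw [q1, q2] at this
        rw [show c / 2 = c - c / 2 by ring, ← this]
        congr 1; ext ω
        constructor
        · rintro ⟨u, v⟩; exact ⟨by linarith, by linarith⟩
        · rintro ⟨u, v⟩; exact ⟨by linarith, by linarith⟩)
      (by
        have := hlt m
        rw [q1] at this
        rw [← this]
        congr 1; ext ω; simp)
    have hs : {ω | -(l - m) ≤ m - Y ω} = {ω | Y ω ≤ l} := by
      ext ω
      constructor
      · intro (u : -(l - m) ≤ m - Y ω)
        exact (by linarith : Y ω ≤ l)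
      · intro (u : Y ω ≤ l)
        exact (by linarith : -(l - m) ≤ m - Y ω)
    have hp := hreal l
    rw [hs, integral_sub (integrable_const m) hYi.restrict] at key
    simp only [integral_const, smul_eq_mul, measureReal_restrict_apply_univ] at key
    rw [hp, q2] at key
    unfold cexp pr
    rw [← measureReal_def, hp, q2, div_le_iff₀ hc0]
    linarith

end
end

section
/- Asymptotic variance computation for the symmetry-bound estimator (algebraic content of Corollary 2). Let f₁ > 0, π_SD > 0, π₁ ∈ (0,1), π₀ := 1 − π₁ > 0, π_S0 > 0, α₀ ∈ (0,1), q₀ > 0, ϑ_L ∈ (0,1], σ_C² ≥ 0 be real numbers with α₀ ≤ q₀. Let G be the 4×4 real matrix with rows (−f₁·π_SD, (ϑ_L/2)·π_SD, 0, 0), (0, π_SD, −π₁, 0), (0, 0, −π₀, 0), (0, 0, 0, −π_S0), and let Σ := diag( (ϑ_L q₀/2)(1 − ϑ_L q₀/2)·π_SD, α₀(q₀ − α₀)·π₁, α₀(1−α₀)·π₀, σ_C²·π_S0 ). Then G is invertible and, for e := (1, 0, 0, −1)ᵀ, eᵀ G⁻¹ Σ (Gᵀ)⁻¹ e = Ω_L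 + σ_C²/π_S0, where Ω_L := f₁⁻² · π_SD⁻¹ · [ (ϑ_L q₀/2)(1 − ϑ_L q₀/2) + (ϑ_L² q₀²/4)·Ψ₁ + (ϑ_L²/4)·Ψ₂ ], Ψ₁ := (α₀/q₀)(1 − α₀/q₀)·π₁/π_SD, and Ψ₂ := α₀(1−α₀)·(π₁/π₀)²·π₀/π_SD. -/
open Matrix

noncomputable section

/-- **Asymptotic variance computation for the symmetry-bound estimator
(algebraic content of Corollary 2).** The Jacobian matrix `G` is invertible and the
sandwich form `eᵀ G⁻¹ Σ (Gᵀ)⁻¹ e` equals `Ω_L + σ_C²/π_S0`. -/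
theorem asymptotic_variance_symmetry_bound
    (f1 πSD π1 π0 πS0 α0 q0 ϑL σC2 : ℝ)
    (hf1 : 0 < f1) (hπSD : 0 < πSD) (hπ1 : π1 ∈ Set.Ioo (0 : ℝ) 1)
    (hπ0 : π0 = 1 - π1) (hπ0pos : 0 < π0) (hπS0 : 0 < πS0)
    (hα0 : α0 ∈ Set.Ioo (0 : ℝ) 1) (hq0 : 0 < q0) (hϑL : ϑL ∈ Set.Ioc (0 : ℝ) 1)
    (hσ : 0 ≤ σC2) (hαq : α0 ≤ q0)
    (G Sg : Matrix (Fin 4) (Fin 4) ℝ) (e : Fin 4 → ℝ)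
    (hG : G = !![-f1 * πSD, (ϑL / 2) * πSD, 0, 0;
                 0, πSD, -π1, 0;
                 0, 0, -π0, 0;
                 0, 0, 0, -πS0])
    (hSg : Sg = Matrix.diagonal
      ![(ϑL * q0 / 2) * (1 - ϑL * q0 / 2) * πSD,
        α0 * (q0 - α0) * π1,
        α0 * (1 - α0) * π0,
        σC2 * πS0])
    (he : e = ![1, 0, 0, -1])
    (Ψ1 Ψ2 ΩL : ℝ)
    (hΨ1 : Ψ1 = (α0 / q0) * (1 - α0 / q0) * π1 / πSD)
    (hΨ2 : Ψ2 = α0 * (1 - α0) * (π1 / π0) ^ 2 * π0 / πSD)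
    (hΩL : ΩL = (f1 ^ 2)⁻¹ * πSD⁻¹ *
      ((ϑL * q0 / 2) * (1 - ϑL * q0 / 2) + (ϑL ^ 2 * q0 ^ 2 / 4) * Ψ1
        + (ϑL ^ 2 / 4) * Ψ2)) :
    IsUnit G.det ∧ e ⬝ᵥ ((G⁻¹ * Sg * (Gᵀ)⁻¹) *ᵥ e) = ΩL + σC2 / πS0 := by
  have h1 : f1 ≠ 0 := hf1.ne'
  have h2 : πSD ≠ 0 := hπSD.ne'
  have h3 : π0 ≠ 0 := hπ0pos.ne'
  have h4 : πS0 ≠ 0 := hπS0.ne'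
  have h5 : q0 ≠ 0 := hq0.ne'
  clear hπ0
  let H : Matrix (Fin 4) (Fin 4) ℝ :=
    !![-1 / (f1 * πSD), ϑL / (2 * f1 * πSD), -(ϑL * π1) / (2 * f1 * πSD * π0), 0;
       0, 1 / πSD, -π1 / (πSD * π0), 0;
       0, 0, -1 / π0, 0;
       0, 0, 0, -1 / πS0]
  have hHG : H * G = 1 := by
    subst hG
    ext i j
    fin_cases i <;> fin_cases j <;>
      simp [H, Matrix.mul_apply, Fin.sum_univ_four] <;> field_simp <;> ring
  have hinv : G⁻¹ = H := Matrix.inv_eq_left_inv hHG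
  refine ⟨Matrix.isUnit_det_of_left_inverse hHG, ?_⟩
  rw [← Matrix.transpose_nonsing_inv, hinv, ← Matrix.mulVec_mulVec, ← Matrix.mulVec_mulVec,
    Matrix.dotProduct_mulVec, ← Matrix.mulVec_transpose]
  have hw : Hᵀ *ᵥ e = ![-1 / (f1 * πSD), ϑL / (2 * f1 * πSD),
      -(ϑL * π1) / (2 * f1 * πSD * π0), 1 / πS0] := by
    subst he
    ext i
    fin_cases i <;> simp [H, Matrix.mulVec, dotProduct, Fin.sum_univ_four] <;> ring
  rw [hw, hSg, hΩL, hΨ1, hΨ2]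
  simp only [dotProduct, Matrix.mulVec_diagonal, Fin.sum_univ_four]
  simp
  field_simp
  ring

end
end

section
/- The folded-tail construction yields proper distribution functions (supporting lemma for the attainability part of Theorem 2). Let F be the CDF of an atomless Borel probability measure on ℝ with Lebesgue density f, let c ∈ (0,1), and let m := inf{t : F(t) ≥ 1 − c/2}, assumed to satisfy F(m) = 1 − c/2. Suppose f(m − a) ≥ f(m + a) for almost every a ≥ 0. Define H(y) := (1/c)·(1 − F(2m − y)) for y < m and H(y) := 1/2 + (1/c)·(F(y) − (1 − c/2)) for y ≥ m. Then: (i) H is the CDF of a Borel probability measure on ℝ that is symmetric about m (H(m+x) + lim_{t↑m−x} H(t) = 1 for all x), so m is a median of H and, if H has finite mean, its mean equals m; and (ii) G(y) := (F(y) − c·H(y))/(1 − c) is also the CDF of a Borel probability measure on ℝ, so that F = c·H + (1−c)·G is a mixture decomposition of F. -/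
open MeasureTheory Set

noncomputable section

/-- **The folded-tail construction yields proper distribution functions.** Folding the
upper tail of `F` about the `1 − c/2` quantile `m` produces a CDF `H` of a probability
measure symmetric about `m` (so `m` is its median and, if integrable, its mean), and
the complementary function `G = (F − c·H)/(1−c)` is also a CDF, giving the mixture
`F = c·H + (1−c)·G`. -/
theorem folded_tail_construction
    (μ : Measure ℝ) [IsProbabilityMeasure μ]
    (F f H : ℝ → ℝ) (c m : ℝ)
    (hF : ∀ t, F t = (μ (Set.Iic t)).toReal)
    (hdens : μ = volume.withDensity fun x => ENNReal.ofReal (f x))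
    (hatomless : ∀ x : ℝ, μ {x} = 0)
    (hc : c ∈ Set.Ioo (0 : ℝ) 1)
    (hm : m = sInf {t : ℝ | 1 - c / 2 ≤ F t})
    (hFm : F m = 1 - c / 2)
    (htail : ∀ᵐ a ∂(volume.restrict (Set.Ici (0 : ℝ))), f (m + a) ≤ f (m - a))
    (hH : ∀ y, H y = if y < m then (1 / c) * (1 - F (2 * m - y))
                     else 1 / 2 + (1 / c) * (F y - (1 - c / 2))) :
    ∃ ν : Measure ℝ, IsProbabilityMeasure ν ∧
      (∀ t, (ν (Set.Iic t)).toReal = H t) ∧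
      (∀ x : ℝ, H (m + x) + (ν (Set.Iio (m - x))).toReal = 1) ∧
      (1 / 2 ≤ (ν (Set.Iic m)).toReal ∧ 1 / 2 ≤ (ν (Set.Ici m)).toReal) ∧
      (Integrable (fun x : ℝ => x) ν → ∫ x, x ∂ν = m) ∧
      ∃ νG : Measure ℝ, IsProbabilityMeasure νG ∧
        (∀ t, (νG (Set.Iic t)).toReal = (F t - c * H t) / (1 - c)) ∧
        μ = ENNReal.ofReal c • ν + ENNReal.ofReal (1 - c) • νG := by
  obtain ⟨hc0, hc1⟩ := hc
  set R : ℝ → ℝ := fun x => 2 * m - x with hR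
  have hRm : Measurable R := by fun_prop
  have hRR : R ∘ R = id := by funext x; simp [hR]
  have hmp : MeasurePreserving R volume volume := Measure.measurePreserving_sub_left volume (2 * m)
  have hemb : MeasurableEmbedding R :=
    (MeasurableEquiv.subLeft (2 * m)).measurableEmbedding
  -- complements and atoms
  have hIoi : ∀ t, (μ (Ioi t)).toReal = 1 - F t := by
    intro t
    rw [hF t, ← compl_Iic]
    exact prob_compl_eq_one_sub measurableSet_Iic |> fun h => by
      rw [h, ENNReal.toReal_sub_of_le prob_le_one ENNReal.one_ne_top]; simp
  haveI : NullSingletonClass μ := ⟨hatomless⟩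
  have hIci : ∀ t, (μ (Ici t)).toReal = 1 - F t := by
    intro t
    rw [← hIoi t, measure_congr Ioi_ae_eq_Ici]
  set μu := μ.restrict (Ioi m) with hμu
  set ρ := μu + μu.map R with hρ
  have hle : μu.map R ≤ μ.restrict (Iic m) := by
    rw [Measure.le_iff]
    intro A hA
    rw [Measure.map_apply hRm hA, hμu, Measure.restrict_apply (hRm hA), Measure.restrict_apply hA]
    have hB : MeasurableSet (R ⁻¹' A ∩ Ioi m) := (hRm hA).inter measurableSet_Ioi
    have hsub : R ⁻¹' A ∩ Ioi m ⊆ R ⁻¹' (A ∩ Iic m) := by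
      rintro x ⟨hx, hx'⟩
      refine ⟨hx, ?_⟩
      simp only [mem_Ioi] at hx'
      simp only [hR, mem_Iic]; linarith
    have hae : ∀ᵐ x ∂(volume.restrict (R ⁻¹' A ∩ Ioi m)),
        ENNReal.ofReal (f x) ≤ ENNReal.ofReal (f (R x)) := by
      rw [ae_restrict_iff' hB]
      rw [ae_restrict_iff' measurableSet_Ici] at htail
      have h2 := (measurePreserving_sub_right volume m).quasiMeasurePreserving.ae htail
      filter_upwards [h2] with x hx hxB
      have hxm : m < x := hxB.2
      have := hx (by simp only [mem_Ici]; linarith)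
      apply ENNReal.ofReal_le_ofReal
      have e1 : m + (x - m) = x := by ring
      have e2 : m - (x - m) = R x := by simp only [hR]; ring
      rwa [e1, e2] at this
    calc μ (R ⁻¹' A ∩ Ioi m) = ∫⁻ x in R ⁻¹' A ∩ Ioi m, ENNReal.ofReal (f x) := by
          rw [hdens, withDensity_apply _ hB]
      _ ≤ ∫⁻ x in R ⁻¹' A ∩ Ioi m, ENNReal.ofReal (f (R x)) := lintegral_mono_ae hae
      _ ≤ ∫⁻ x in R ⁻¹' (A ∩ Iic m), ENNReal.ofReal (f (R x)) := lintegral_mono_set hsub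
      _ = ∫⁻ x in A ∩ Iic m, ENNReal.ofReal (f x) :=
          hmp.setLIntegral_comp_preimage_emb hemb (fun x => ENNReal.ofReal (f x)) _
      _ = μ (A ∩ Iic m) := by
          conv_rhs => rw [hdens, withDensity_apply _ (hA.inter measurableSet_Iic)]
  have hρμ : ρ ≤ μ := by
    calc ρ ≤ μu + μ.restrict (Iic m) := add_le_add le_rfl hle
      _ = μ := by
        rw [hμu, ← compl_Iic, add_comm]
        exact Measure.restrict_add_restrict_compl measurableSet_Iic
  haveI : IsFiniteMeasure ρ := isFiniteMeasure_of_le μ hρμ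
  have hρR : ρ.map R = ρ := by
    rw [hρ, Measure.map_add _ _ hRm, Measure.map_map hRm hRm, hRR, Measure.map_id, add_comm]
  have hρt : ∀ t, (ρ (Iic t)).toReal = c * H t := by
    intro t
    have hpre : R ⁻¹' (Iic t) = Ici (2 * m - t) := by
      ext x; simp only [hR, mem_preimage, mem_Iic, mem_Ici]; constructor <;> intro h <;> linarith
    rw [hρ, Measure.add_apply, Measure.map_apply hRm measurableSet_Iic, hpre, hμu,
      Measure.restrict_apply measurableSet_Iic, Measure.restrict_apply measurableSet_Ici,
      ENNReal.toReal_add (measure_ne_top _ _) (measure_ne_top _ _), hH t]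
    split_ifs with h
    · have h1 : Iic t ∩ Ioi m = ∅ := by
        ext x; simp only [mem_inter_iff, mem_Iic, mem_Ioi, mem_empty_iff_false, iff_false]
        rintro ⟨a, b⟩; linarith
      have h2 : Ici (2 * m - t) ∩ Ioi m = Ici (2 * m - t) := by
        apply inter_eq_left.2
        intro x hx; simp only [mem_Ici, mem_Ioi] at *; linarith
      rw [h1, h2, hIci]; simp; field_simp
    · push Not at h
      have h2 : Ici (2 * m - t) ∩ Ioi m = Ioi m := by
        apply inter_eq_right.2
        intro x hx; simp only [mem_Ici, mem_Ioi] at *; linarith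
      have h1 : Iic t ∩ Ioi m = Iic t \ Iic m := by
        rw [← compl_Iic]; rfl
      have h3 : (μ (Iic t \ Iic m)).toReal = F t - F m := by
        rw [hF, hF]
        exact measureReal_sdiff (Iic_subset_Iic.2 h) measurableSet_Iic
      rw [h1, h2, h3, hIoi, hFm]; field_simp; ring
  have hρuniv : ρ univ = ENNReal.ofReal c := by
    have h1 : (μ (Ioi m)) = ENNReal.ofReal (c / 2) := by
      rw [← ENNReal.ofReal_toReal (measure_ne_top μ (Ioi m)), hIoi, hFm]; congr 1; ring
    rw [hρ, Measure.add_apply, Measure.map_apply hRm MeasurableSet.univ, preimage_univ, hμu,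
      Measure.restrict_apply_univ, h1, ← ENNReal.ofReal_add (by positivity) (by positivity)]
    congr 1; ring
  have hc' : ENNReal.ofReal c ≠ 0 := by simpa using hc0
  have hd' : ENNReal.ofReal (1 - c) ≠ 0 := by simpa using hc1
  have key : μ - ρ + ρ = μ := Measure.sub_add_cancel_of_le hρμ
  have hsubuniv : (μ - ρ) univ = ENNReal.ofReal (1 - c) := by
    rw [Measure.sub_apply MeasurableSet.univ hρμ, hρuniv, measure_univ,
      ENNReal.ofReal_sub _ hc0.le, ENNReal.ofReal_one]
  have hsubt : ∀ t, ((μ - ρ) (Iic t)).toReal = F t - c * H t := by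
    intro t
    rw [Measure.sub_apply measurableSet_Iic hρμ,
      ENNReal.toReal_sub_of_le (hρμ _) (measure_ne_top _ _), hρt, hF]
  set ν := (ENNReal.ofReal c)⁻¹ • ρ with hν
  have hνP : IsProbabilityMeasure ν := ⟨by
    rw [hν, Measure.smul_apply, hρuniv, smul_eq_mul, ENNReal.inv_mul_cancel hc' ENNReal.ofReal_ne_top]⟩
  have hνt : ∀ t, (ν (Iic t)).toReal = H t := by
    intro t
    rw [hν, Measure.smul_apply, smul_eq_mul, ENNReal.toReal_mul, hρt, ENNReal.toReal_inv,
      ENNReal.toReal_ofReal hc0.le]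
    field_simp
  have hνR : ν.map R = ν := by rw [hν, Measure.map_smul, hρR]
  have hHm : H m = 1 / 2 := by rw [hH, if_neg (lt_irrefl m), hFm]; simp
  refine ⟨ν, hνP, hνt, ?_, ⟨?_, ?_⟩, ?_, (ENNReal.ofReal (1 - c))⁻¹ • (μ - ρ), ⟨?_⟩, ?_, ?_⟩
  · intro x
    have h1 : ν (Iio (m - x)) = ν (Iic (m + x))ᶜ := by
      conv_lhs => rw [← hνR, Measure.map_apply hRm measurableSet_Iio]
      congr 1
      ext y; simp only [hR, mem_preimage, mem_Iio, mem_compl_iff, mem_Iic, not_le]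
      constructor <;> intro h <;> linarith
    rw [h1, ← hνt]
    exact probReal_add_probReal_compl measurableSet_Iic
  · rw [hνt, hHm]
  · have h1 : ν (Ici m) = ν (Iic m) := by
      conv_lhs => rw [← hνR, Measure.map_apply hRm measurableSet_Ici]
      congr 1
      ext y; simp only [hR, mem_preimage, mem_Ici, mem_Iic]
      constructor <;> intro h <;> linarith
    rw [h1, hνt, hHm]
  · intro hint
    have h1 : ∫ x, x ∂ν = ∫ x, R x ∂ν := by
      conv_lhs => rw [← hνR]
      exact integral_map hRm.aemeasurable (by fun_prop)
    have h2 : ∫ x, R x ∂ν = 2 * m - ∫ x, x ∂ν := by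
      simp only [hR]
      rw [integral_sub (integrable_const _) hint]; simp
    linarith
  · rw [Measure.smul_apply, hsubuniv, smul_eq_mul, ENNReal.inv_mul_cancel hd' ENNReal.ofReal_ne_top]
  · intro t
    rw [Measure.smul_apply, smul_eq_mul, ENNReal.toReal_mul, hsubt, ENNReal.toReal_inv,
      ENNReal.toReal_ofReal (by linarith)]
    field_simp
  · rw [hν, smul_smul, smul_smul, ENNReal.mul_inv_cancel hc' ENNReal.ofReal_ne_top,
      ENNReal.mul_inv_cancel hd' ENNReal.ofReal_ne_top, one_smul, one_smul, add_comm, key]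

end
end
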